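/- If G is a graph that is not a forest, then the connected tree-width of G is at most 2(cbn(G) − 1)(cbn(G) − 2), where cbn(G) is the maximum connected order of any bramble of G. -/

import Mathlib

open SimpleGraph

universe u

/-- `x` and `y` are joined by a walk in `G` all of whose vertices lie in `S`. -/
def ConnIn {V : Type u} (G : SimpleGraph V) (S : Set V) (x y : V) : Prop :=
  ∃ p : G.Walk x y, ∀ v ∈ p.support, v ∈ S

/-- `S` is a (nonempty) connected vertex set of `G`, i.e. `G[S]` is connected. -/
def IsConnSet {V : Type u} (G : SimpleGraph V) (S : Set V) : Prop :=
  S.Nonempty ∧ ∀ x ∈ S, ∀ y ∈ S, ConnIn G S x y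

/-- A tree-decomposition of `G` over the tree `T`. -/
structure TreeDecomp {V ι : Type u} (G : SimpleGraph V) (T : SimpleGraph ι) where
  isTree : T.IsTree
  bag : ι → Set V
  exists_bag : ∀ v : V, ∃ t, v ∈ bag t
  exists_bag_adj : ∀ ⦃u v : V⦄, G.Adj u v → ∃ t, u ∈ bag t ∧ v ∈ bag t
  bag_sep : ∀ ⦃t₁ t₃ : ι⦄ (p : T.Walk t₁ t₃), p.IsPath → ∀ t₂ ∈ p.support,
      bag t₁ ∩ bag t₃ ⊆ bag t₂

/-- The union of the bags `B u` over `u ∈ A`. -/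
def unionBags {V ι : Type u} (B : ι → Set V) (A : Set ι) : Set V := ⋃ u ∈ A, B u

/-- `s` is a descendant of `t` in the tree `T` rooted at `r`:
`t` lies on the (unique) `r`–`s` path. -/
def Desc {ι : Type u} (T : SimpleGraph ι) (r t s : ι) : Prop :=
  ∃ p : T.Walk r s, p.IsPath ∧ t ∈ p.support

/-- The set of descendants of `t` (the subtree `T_t`). -/
def descSet {ι : Type u} (T : SimpleGraph ι) (r t : ι) : Set ι := {s | Desc T r t s}

/-- `s` is a child of `t` in the tree `T` rooted at `r`. -/
def IsChild {ι : Type u} (T : SimpleGraph ι) (r t s : ι) : Prop :=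
  T.Adj t s ∧ Desc T r t s

/-- The vertex set of the component of `t₁` in `T` minus the edge `t₁t₂`. -/
def Side {ι : Type u} (T : SimpleGraph ι) (t₁ t₂ : ι) : Set ι :=
  {u | ∃ p : T.Walk u t₁, p.IsPath ∧ t₂ ∉ p.support}

/-- The family of bags `B` is stable: for every tree edge `t₁t₂`, both sides
induce connected subgraphs of `G`. -/
def StableBags {V ι : Type u} (G : SimpleGraph V) (T : SimpleGraph ι) (B : ι → Set V) : Prop :=
  ∀ ⦃t₁ t₂ : ι⦄, T.Adj t₁ t₂ → IsConnSet G (unionBags B (Side T t₁ t₂))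

def TreeDecomp.Stable {V ι : Type u} {G : SimpleGraph V} {T : SimpleGraph ι}
    (td : TreeDecomp G T) : Prop :=
  StableBags G T td.bag

/-- `P` is a `t`-admissible path (w.r.t. the root `r` and bags `B`): a shortest
path lying in `V_{T_t}` joining two distinct components of `G[B t]`. -/
structure IsAdmissible {V ι : Type u} (G : SimpleGraph V) (T : SimpleGraph ι)
    (B : ι → Set V) (r t : ι) {x y : V} (P : G.Walk x y) : Prop where
  isPath : P.IsPath
  support_sub : ∀ v ∈ P.support, v ∈ unionBags B (descSet T r t)
  fst_mem : x ∈ B t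
  snd_mem : y ∈ B t
  not_conn : ¬ ConnIn G (B t) x y
  minimal : ∀ ⦃x' y' : V⦄ (Q : G.Walk x' y'), Q.IsPath →
      (∀ v ∈ Q.support, v ∈ unionBags B (descSet T r t)) →
      x' ∈ B t → y' ∈ B t → ¬ ConnIn G (B t) x' y' → P.length ≤ Q.length

/-- The updated bags obtained by adding the path `P` as in `(*)`:
`W_u = V_u ∪ (V(P) ∩ V_{T_u})` for descendants `u` of `t`, and `W_u = V_u` otherwise. -/
def updatedBag {V ι : Type u} (T : SimpleGraph ι) (B : ι → Set V) (r t : ι)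
    {G : SimpleGraph V} {x y : V} (P : G.Walk x y) (u : ι) : Set V :=
  B u ∪ {v | Desc T r t u ∧ v ∈ P.support ∧ v ∈ unionBags B (descSet T r u)}

/-- The tree-width of `G`: the least `k` such that `G` has a tree-decomposition
all of whose bags have at most `k + 1` vertices. -/
noncomputable def treewidth {V : Type u} (G : SimpleGraph V) : ℕ :=
  sInf {k | ∃ (ι : Type u) (T : SimpleGraph ι) (td : TreeDecomp G T),
    ∀ t, (td.bag t).ncard ≤ k + 1}

/-- A tree-decomposition is connected if every bag is a connected vertex set. -/
def TreeDecomp.IsConn {V ι : Type u} {G : SimpleGraph V} {T : SimpleGraph ι}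
    (td : TreeDecomp G T) : Prop :=
  ∀ t, IsConnSet G (td.bag t)

/-- The connected tree-width of `G`. -/
noncomputable def ctw {V : Type u} (G : SimpleGraph V) : ℕ :=
  sInf {k | ∃ (ι : Type u) (T : SimpleGraph ι) (td : TreeDecomp G T),
    td.IsConn ∧ ∀ t, (td.bag t).ncard ≤ k + 1}

/-- The weak connected tree-width of `G`: the least `k` such that `G` has a
tree-decomposition each of whose bags is contained in a connected set of at
most `k + 1` vertices. -/
noncomputable def wctw {V : Type u} (G : SimpleGraph V) : ℕ :=
  sInf {k | ∃ (ι : Type u) (T : SimpleGraph ι) (td : TreeDecomp G T),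
    ∀ t, ∃ X, td.bag t ⊆ X ∧ IsConnSet G X ∧ X.ncard ≤ k + 1}

/-- The characteristic vector over GF(2) of the edge set of a walk. -/
noncomputable def walkChar {V : Type u} {G : SimpleGraph V} {x y : V}
    (p : G.Walk x y) : Sym2 V → ZMod 2 :=
  fun e => by classical exact if e ∈ p.edges then 1 else 0

/-- The characteristic vectors of the cycles of `G` of length at most `ℓ`. -/
def cycleChars {V : Type u} (G : SimpleGraph V) (ℓ : ℕ) : Set (Sym2 V → ZMod 2) :=
  {f | ∃ (v : V) (p : G.Walk v v), p.IsCycle ∧ p.length ≤ ℓ ∧ f = walkChar p}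

/-- The cycles of length at most `ℓ` generate the cycle space of `G` over GF(2). -/
def GeneratesLE {V : Type u} (G : SimpleGraph V) (ℓ : ℕ) : Prop :=
  ∀ ⦃v : V⦄ (p : G.Walk v v), p.IsCycle →
    walkChar p ∈ Submodule.span (ZMod 2) (cycleChars G ℓ)

/-- `ℓ(G)`: the least `ℓ` such that the cycles of length at most `ℓ`
generate the cycle space of `G`. -/
noncomputable def ellGraph {V : Type u} (G : SimpleGraph V) : ℕ :=
  sInf {ℓ | GeneratesLE G ℓ}

/-- `Γ` is a set of cycles of `G` generating its cycle space over GF(2). -/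
def GeneratesSet {V : Type u} (G : SimpleGraph V) (Γ : Set (Σ v : V, G.Walk v v)) : Prop :=
  (∀ c ∈ Γ, c.2.IsCycle) ∧
  ∀ ⦃v : V⦄ (p : G.Walk v v), p.IsCycle →
    walkChar p ∈ Submodule.span (ZMod 2) {f | ∃ c ∈ Γ, f = walkChar c.2}

/-- A bramble: a collection of connected vertex sets, any two of which have
connected union. -/
def IsBramble {V : Type u} (G : SimpleGraph V) (B : Set (Set V)) : Prop :=
  (∀ S ∈ B, IsConnSet G S) ∧ ∀ S ∈ B, ∀ S' ∈ B, IsConnSet G (S ∪ S')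

/-- `X` is a connected cover of the bramble `B`. -/
def IsConnCover {V : Type u} (G : SimpleGraph V) (B : Set (Set V)) (X : Set V) : Prop :=
  IsConnSet G X ∧ ∀ S ∈ B, (X ∩ S).Nonempty

/-- The connected order of a bramble: the least size of a connected cover. -/
noncomputable def connOrder {V : Type u} (G : SimpleGraph V) (B : Set (Set V)) : ℕ :=
  sInf {n | ∃ X, IsConnCover G B X ∧ X.ncard = n}

/-- The maximum connected order of a bramble of `G`. -/
noncomputable def cbn {V : Type u} (G : SimpleGraph V) : ℕ :=
  sSup {n | ∃ B, IsBramble G B ∧ connOrder G B = n}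

/-- A geodesic cycle: a cycle containing a shortest `G`-path between any two
of its vertices. -/
def IsGeodesicCycle {V : Type u} (G : SimpleGraph V) {v : V} (p : G.Walk v v) : Prop :=
  p.IsCycle ∧ ∀ x ∈ p.support, ∀ y ∈ p.support,
    ∃ q : G.Walk x y, q.length = G.dist x y ∧ ∀ e ∈ q.edges, e ∈ p.edges

/-- The graph obtained from `K_n` by subdividing every edge exactly `k` times:
the edge between `i < j` is replaced by the path
`i, ((i,j),0), ((i,j),1), …, ((i,j),k-1), j`. -/
def subK (n k : ℕ) : SimpleGraph (Fin n ⊕ ({p : Fin n × Fin n // p.1 < p.2} × Fin k)) :=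
  SimpleGraph.fromRel fun u v =>
    match u, v with
    | Sum.inl i, Sum.inl j => i < j ∧ k = 0
    | Sum.inl i, Sum.inr (e, c) =>
        (e.val.1 = i ∧ (c : ℕ) = 0) ∨ (e.val.2 = i ∧ (c : ℕ) = k - 1)
    | Sum.inr (e, c), Sum.inr (e', c') => e = e' ∧ (c' : ℕ) = (c : ℕ) + 1
    | _, _ => False

namespace ConnTW

section

variable {V : Type u} {G : SimpleGraph V} {S S' : Set V} {u v w : V}

/-- `u` and `v` are equal or joined by a chain of adjacent vertices of `S`. -/
def LinkedIn (G : SimpleGraph V) (S : Set V) : V → V → Prop :=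
  Relation.ReflTransGen fun u v => G.Adj u v ∧ u ∈ S ∧ v ∈ S

namespace LinkedIn

@[refl] lemma refl (v : V) : LinkedIn G S v v := Relation.ReflTransGen.refl

lemma trans (h : LinkedIn G S u v) (h' : LinkedIn G S v w) : LinkedIn G S u w :=
  Relation.ReflTransGen.trans h h'

lemma symm (h : LinkedIn G S u v) : LinkedIn G S v u := by
  induction h with
  | refl => rfl
  | tail _ h ih => exact Relation.ReflTransGen.head ⟨h.1.symm, h.2.2, h.2.1⟩ ih

lemma of_adj (h : G.Adj u v) (hu : u ∈ S) (hv : v ∈ S) : LinkedIn G S u v :=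
  Relation.ReflTransGen.single ⟨h, hu, hv⟩

lemma mono {H : SimpleGraph V} (hG : G ≤ H) (hS : S ⊆ S') (h : LinkedIn G S u v) :
    LinkedIn H S' u v :=
  Relation.ReflTransGen.mono (fun _ _ h => ⟨hG h.1, hS h.2.1, hS h.2.2⟩) _ _ h

lemma mono_set (hS : S ⊆ S') (h : LinkedIn G S u v) : LinkedIn G S' u v := h.mono le_rfl hS

lemma mem (h : LinkedIn G S u v) (hu : u ∈ S) : v ∈ S := by
  induction h with
  | refl => exact hu
  | tail _ h _ => exact h.2.2

lemma mem_of_ne (h : LinkedIn G S u v) (hne : u ≠ v) : u ∈ S ∧ v ∈ S := by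
  induction h with
  | refl => exact absurd rfl hne
  | @tail b c _ h ih =>
    by_cases hb : u = b
    · exact ⟨hb ▸ h.2.1, h.2.2⟩
    · exact ⟨(ih hb).1, h.2.2⟩

lemma of_walk (p : G.Walk u v) (hp : ∀ x ∈ p.support, x ∈ S) : LinkedIn G S u v := by
  induction p with
  | nil => rfl
  | cons h p ih =>
    refine (of_adj h (hp _ (by simp)) (hp _ (by simp))).trans (ih fun x hx => hp x ?_)
    simp [hx]

lemma exists_walk (h : LinkedIn G S u v) (hu : u ∈ S) :
    ∃ p : G.Walk u v, ∀ x ∈ p.support, x ∈ S := by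
  induction h with
  | refl => exact ⟨.nil, by simpa using hu⟩
  | tail _ h ih =>
    obtain ⟨p, hp⟩ := ih
    refine ⟨p.concat h.1, fun x hx => ?_⟩
    rw [Walk.support_concat] at hx
    simp only [List.mem_append, List.mem_singleton] at hx
    rcases hx with hx | rfl
    · exact hp x hx
    · exact h.2.2

lemma connIn (h : LinkedIn G S u v) (hu : u ∈ S) : ConnIn G S u v := h.exists_walk hu

end LinkedIn

lemma isConnSet_iff : IsConnSet G S ↔ S.Nonempty ∧ ∀ x ∈ S, ∀ y ∈ S, LinkedIn G S x y :=
  and_congr_right fun _ =>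
    ⟨fun h x hx y hy => (h x hx y hy).elim fun p hp => .of_walk p hp,
      fun h x hx y hy => (h x hx y hy).connIn hx⟩

lemma isConnSet_of_linkedIn {x : V} (hx : x ∈ S) (h : ∀ y ∈ S, LinkedIn G S x y) :
    IsConnSet G S :=
  isConnSet_iff.2 ⟨⟨x, hx⟩, fun y hy z hz => (h y hy).symm.trans (h z hz)⟩

lemma _root_.IsConnSet.linkedIn (h : IsConnSet G S) {x y : V} (hx : x ∈ S) (hy : y ∈ S) :
    LinkedIn G S x y := (isConnSet_iff.1 h).2 x hx y hy

/-- The set of vertices linked to `x` in `S`. -/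
def comp (G : SimpleGraph V) (S : Set V) (x : V) : Set V := {v | LinkedIn G S x v}

lemma mem_comp_self (x : V) : x ∈ comp G S x := LinkedIn.refl x

lemma comp_subset {x : V} (hx : x ∈ S) : comp G S x ⊆ S := fun _ h => LinkedIn.mem h hx

lemma isConnSet_comp (x : V) : IsConnSet G (comp G S x) := by
  refine isConnSet_of_linkedIn (mem_comp_self x) fun y hy => ?_
  induction hy with
  | refl => rfl
  | tail h h' ih => exact ih.trans (.of_adj h'.1 h (h.tail h'))

lemma comp_closed {x : V} (hx : x ∈ S) {a b : V} (ha : a ∈ comp G S x) (hab : G.Adj a b)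
    (hb : b ∈ S) : b ∈ comp G S x :=
  LinkedIn.trans ha (.of_adj hab (comp_subset hx ha) hb)

/-- The vertices outside `C` with a neighbour in `C`. -/
def bdry (G : SimpleGraph V) (C : Set V) : Set V := {v | v ∉ C ∧ ∃ c ∈ C, G.Adj c v}

lemma mem_or_mem_bdry {C : Set V} {c v : V} (hc : c ∈ C) (h : G.Adj c v) :
    v ∈ C ∨ v ∈ bdry G C := by
  by_cases hv : v ∈ C
  · exact .inl hv
  · exact .inr ⟨hv, c, hc, h⟩

lemma disjoint_bdry {C : Set V} : Disjoint C (bdry G C) :=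
  Set.disjoint_right.2 fun _ h => h.1

lemma bdry_comp_subset {x : V} (hx : x ∈ S) : bdry G (comp G S x) ⊆ Sᶜ :=
  fun _ hv hvS => hv.1 (hv.2.elim fun _ hc => comp_closed hx hc.1 hc.2 hvS)

lemma le_cbn [Finite V] {𝓑 : Set (Set V)} (hb : IsBramble G 𝓑) (hne : 𝓑.Nonempty) {n : ℕ}
    (h : ∀ X, IsConnCover G 𝓑 X → n ≤ X.ncard) : n ≤ cbn G := by
  have hord : ∀ 𝓒 : Set (Set V), connOrder G 𝓒 ≤ Nat.card V := by
    intro 𝓒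
    by_cases hs : {n | ∃ X, IsConnCover G 𝓒 X ∧ X.ncard = n}.Nonempty
    · obtain ⟨X, -, hX⟩ := Nat.sInf_mem hs
      exact hX.symm.le.trans (Set.ncard_le_card X)
    · unfold connOrder
      rw [Set.not_nonempty_iff_eq_empty.1 hs]
      simp
  have hle : connOrder G 𝓑 ≤ cbn G :=
    le_csSup ⟨Nat.card V, by rintro _ ⟨𝓒, -, rfl⟩; exact hord 𝓒⟩ ⟨𝓑, hb, rfl⟩
  refine le_trans ?_ hle
  obtain ⟨S₀, hS₀⟩ := hne
  obtain ⟨s, hs⟩ := (hb.1 S₀ hS₀).1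
  have hcov : IsConnCover G 𝓑 (comp G Set.univ s) := by
    refine ⟨isConnSet_comp s, fun S hS => ?_⟩
    obtain ⟨t, ht⟩ := (hb.1 S hS).1
    exact ⟨t, ((hb.2 S₀ hS₀ S hS).linkedIn (.inl hs) (.inr ht)).mono_set (Set.subset_univ _), ht⟩
  refine le_csInf ⟨_, _, hcov, rfl⟩ ?_
  rintro _ ⟨X, hX, rfl⟩
  exact h X hX

end

section

variable {V : Type u} {G : SimpleGraph V} {Q : Set V → Prop} {𝓢 : Set (Set V)} {A A' B B' : Set V}

/-- `RD G Q 𝓢 B A` says that `A` has a rooted tree-decomposition whose root part is `B`, all of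
whose parts satisfy `Q` except for leaves whose private vertices form an element of `𝓢`. -/
inductive RD (G : SimpleGraph V) (Q : Set V → Prop) (𝓢 : Set (Set V)) : Set V → Set V → Prop
  | node {B : Set V} : Q B → RD G Q 𝓢 B B
  | leaf {B A C : Set V} : RD G Q 𝓢 B A → C ∈ 𝓢 → Disjoint C A → bdry G C ⊆ B →
      RD G Q 𝓢 B (A ∪ C)
  | attach {B A B' A' : Set V} : RD G Q 𝓢 B A → RD G Q 𝓢 B' A' → A ∩ A' ⊆ B ∩ B' →
      (∀ a ∈ A', a ∉ B → ∀ v, G.Adj a v → v ∈ A ∪ A') →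
      (∀ u ∈ A, ∀ v ∈ A', G.Adj u v → u ∈ A' ∨ v ∈ A) → RD G Q 𝓢 B (A ∪ A')

namespace RD

lemma root (h : RD G Q 𝓢 B A) : Q B := by
  induction h with
  | node h => exact h
  | leaf _ _ _ _ ih => exact ih
  | attach _ _ _ _ _ ih _ => exact ih

lemma subset (h : RD G Q 𝓢 B A) : B ⊆ A := by
  induction h with
  | node _ => exact subset_rfl
  | leaf _ _ _ _ ih => exact ih.trans Set.subset_union_left
  | attach _ _ _ _ _ ih _ => exact ih.trans Set.subset_union_left

lemma closed (h : RD G Q 𝓢 B A) : ∀ a ∈ A, a ∉ B → ∀ v, G.Adj a v → v ∈ A := by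
  induction h with
  | node _ => exact fun a ha hb => absurd ha hb
  | leaf h hC hd hb ih =>
    rintro a (ha | ha) haB v hav
    · exact .inl (ih a ha haB v hav)
    · rcases mem_or_mem_bdry ha hav with hv | hv
      · exact .inr hv
      · exact .inl (h.subset (hb hv))
  | attach h h' hi hc he ih ih' =>
    rintro a (ha | ha) haB v hav
    · exact .inl (ih a ha haB v hav)
    · exact hc a ha haB v hav

lemma join {A₀ : Set V} (h : RD G Q 𝓢 B A) (h₀ : RD G Q 𝓢 B A₀) (hi : A ∩ A₀ ⊆ B) :
    RD G Q 𝓢 B (A ∪ A₀) := by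
  refine h.attach h₀ (fun x hx => ⟨hi hx, hi hx⟩)
    (fun a ha haB v hav => .inr (h₀.closed a ha haB v hav)) fun u hu v hv huv => ?_
  by_cases hvB : v ∈ B
  · exact .inr (h.subset hvB)
  · exact .inl (h₀.closed v hv hvB u huv.symm)

/-- A decomposition using the leaf `M` can be rerooted at the neighbour of that leaf. -/
lemma reroot {M : Set V} (hM : M.Nonempty) (h : RD G Q (insert M 𝓢) B A) :
    RD G Q 𝓢 B A ∨ (M ⊆ A ∧ Disjoint M B ∧ ∀ A₀, RD G Q 𝓢 B A₀ → A ∩ A₀ ⊆ B →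
      A ∪ A₀ = Set.univ → ∃ B₁, RD G Q 𝓢 B₁ Mᶜ ∧ bdry G M ⊆ B₁) := by
  obtain ⟨m, hm⟩ := hM
  induction h with
  | node h => exact .inl (.node h)
  | @leaf B A C h hC hd hb ih =>
    rcases ih with ih | ⟨hMA, hMB, ih⟩
    · rcases hC with rfl | hC
      · refine .inr ⟨Set.subset_union_right, hd.mono_right h.subset, fun A₀ h₀ hi hu => ?_⟩
        refine ⟨B, ?_, hb⟩
        have : Cᶜ = A ∪ A₀ := by
          ext x
          have h1 : x ∈ C → x ∉ A := fun h h' => Set.disjoint_left.1 hd h h'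
          have h2 := @hi x
          have h3 := @RD.subset _ _ _ _ _ _ h x
          have h4 : x ∈ A ∪ C ∪ A₀ := hu ▸ Set.mem_univ x
          simp only [Set.mem_inter_iff, Set.mem_union, Set.mem_compl_iff] at *
          tauto
        rw [this]
        exact ih.join h₀ fun x hx => hi ⟨.inl hx.1, hx.2⟩
      · exact .inl (ih.leaf hC hd hb)
    · rcases hC with rfl | hC
      · exact absurd (hMA hm) (Set.disjoint_left.1 hd hm)
      · refine .inr ⟨hMA.trans Set.subset_union_left, hMB, fun A₀ h₀ hi hu => ?_⟩
        refine ih (A₀ ∪ C) (h₀.leaf hC ?_ hb) ?_ ?_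
        · refine Set.disjoint_left.2 fun x hx hx₀ => ?_
          exact Set.disjoint_left.1 hd hx (h.subset (hi ⟨.inr hx, hx₀⟩))
        · rintro x ⟨hx, hx₀ | hxC⟩
          · exact hi ⟨.inl hx, hx₀⟩
          · exact absurd hx (Set.disjoint_left.1 hd hxC)
        · rw [← hu, Set.union_right_comm, Set.union_assoc]
  | @attach B A B' A' h h' hi hc he ih ih' =>
    rcases ih with ih | ⟨hMA, hMB, ih⟩
    · rcases ih' with ih' | ⟨hMA', hMB', ih'⟩
      · exact .inl (ih.attach ih' hi hc he)
      · refine .inr ⟨hMA'.trans Set.subset_union_right, ?_, fun A₀ h₀ hi₀ hu => ?_⟩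
        · refine Set.disjoint_left.2 fun x hx hxB => ?_
          exact Set.disjoint_left.1 hMB' hx (hi ⟨h.subset hxB, hMA' hx⟩).2
        have hroot : Q B' := h'.root
        have hA : ∀ x ∈ A', x ∈ A ∪ A₀ → x ∈ B ∧ x ∈ B' := by
          rintro x hx (hxA | hxA)
          · exact hi ⟨hxA, hx⟩
          · exact hi ⟨h.subset (hi₀ ⟨.inr hx, hxA⟩), hx⟩
        refine ih' (B' ∪ (A ∪ A₀)) ((node hroot).attach
          (ih.join h₀ fun x hx => hi₀ ⟨.inl hx.1, hx.2⟩) ?_ ?_ ?_) ?_ ?_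
        · exact fun x hx => (hA x (h'.subset hx.1) hx.2).symm
        · intro a ha haB' v hav
          by_contra hv
          have hvu : v ∈ A ∪ A' ∪ A₀ := hu ▸ Set.mem_univ v
          simp only [Set.mem_union, not_or] at hv hvu
          have hvA' : v ∈ A' := by tauto
          exact haB' (hA a (h'.closed v hvA' hv.1 a hav.symm) ha).2
        · intro u hu' v hv huv
          by_contra! hcon
          have huA' := h'.subset hu'
          have huB : u ∉ B := fun hB => hcon.1 (.inl (h.subset hB))
          have hvA' : v ∉ A' := fun hA' => hcon.2 (hA v hA' hv).2
          rcases hc u huA' huB v huv with hvA | hvA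
          · rcases he v hvA u huA' huv.symm with h1 | h1
            · exact hvA' h1
            · exact hcon.1 (.inl h1)
          · exact hvA' hvA
        · rintro x ⟨hx, hx' | hx'⟩
          · exact hx'
          · exact (hA x hx hx').2
        · refine Set.eq_univ_of_univ_subset ?_
          rw [← hu]
          rintro x ((hx | hx) | hx)
          · exact .inr (.inr (.inl hx))
          · exact .inl hx
          · exact .inr (.inr (.inr hx))
    · rcases ih' with ih' | ⟨hMA', hMB', ih'⟩
      · refine .inr ⟨hMA.trans Set.subset_union_left, hMB, fun A₀ h₀ hi₀ hu => ?_⟩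
        have hcl : ∀ a ∈ A', a ∉ B → ∀ v, G.Adj a v → v ∈ A' := by
          intro a ha haB v hav
          rcases hc a ha haB v hav with hv | hv
          · exact (he v hv a ha hav.symm).resolve_right fun h1 => haB (hi ⟨h1, ha⟩).1
          · exact hv
        refine ih (A₀ ∪ A') (h₀.attach ih' ?_ ?_ ?_) ?_ ?_
        · exact fun x hx => hi ⟨h.subset (hi₀ ⟨.inr hx.2, hx.1⟩), hx.2⟩
        · exact fun a ha haB v hav => .inr (hcl a ha haB v hav)
        · intro u hu' v hv huv
          by_cases hvB : v ∈ B
          · exact .inr (h₀.subset hvB)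
          · exact .inl (hcl v hv hvB u huv.symm)
        · rintro x ⟨hx, hx' | hx'⟩
          · exact hi₀ ⟨.inl hx, hx'⟩
          · exact (hi ⟨hx, hx'⟩).1
        · rw [← hu, Set.union_right_comm, Set.union_assoc]
      · exact absurd (hi ⟨hMA hm, hMA' hm⟩).1 (Set.disjoint_left.1 hMB hm)

end RD

/-- The vertices reachable from `M` by a walk avoiding `W` with no inner vertex in `Z`. -/
inductive Rch (G : SimpleGraph V) (M Z W : Set V) : V → Prop
  | base {m : V} : m ∈ M → m ∉ W → Rch G M Z W m
  | step {v w : V} : Rch G M Z W v → v ∉ Z → G.Adj v w → w ∉ W → Rch G M Z W w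

namespace Rch

variable {M Z W W' T : Set V} {v : V}

lemma notMem_of_closed (hT : ∀ t ∈ T, ∀ v, G.Adj t v → v ∈ T ∪ Z) (hM : Disjoint M T)
    (h : Rch G M Z W v) : v ∉ T := by
  induction h with
  | base hm _ => exact Set.disjoint_left.1 hM hm
  | @step v w _ hv hvw _ ih => exact fun hw => (hT w hw v hvw.symm).elim ih hv

lemma notMem_of_disjoint (hA : ∀ a ∈ A, a ∉ W → ∀ v, G.Adj a v → v ∈ A) (hM : Disjoint A M)
    (h : Rch G M Z W v) : v ∉ A := by
  induction h with
  | base hm _ => exact Set.disjoint_right.1 hM hm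
  | @step v w _ _ hvw hw ih => exact fun hwA => ih (hA w hwA hw v hvw.symm)

lemma mono (hW : ∀ v, Rch G M Z W v → v ∉ W') (h : Rch G M Z W v) : Rch G M Z W' v := by
  induction h with
  | base hm hw => exact .base hm (hW _ (.base hm hw))
  | step h hv hvw hw ih => exact .step ih hv hvw (hW _ (.step h hv hvw hw))

end Rch

/-- Pushing a decomposition of the complement of `M` across a minimum separator `Z`. -/
lemma RD.shift [Finite V] {k : ℕ} {M Z T : Set V} (hS : ∀ S ∈ 𝓢, ∀ S' ⊆ S, S' ∈ 𝓢)
    (hZT : Disjoint Z T) (hT : ∀ t ∈ T, ∀ v, G.Adj t v → v ∈ T ∪ Z) (hM : Disjoint M (T ∪ Z))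
    (hmin : ∀ R, M ⊆ R → Disjoint R (T ∪ Z) → Z.ncard ≤ (bdry G R).ncard)
    (h : RD G (fun B => B.ncard ≤ k) 𝓢 B A) (hA : Disjoint A M) :
    RD G (fun B => B.ncard ≤ k) 𝓢 (B ∩ T ∪ {z ∈ Z | ¬ Rch G M Z B z})
      (A ∩ T ∪ {z ∈ Z | ¬ Rch G M Z B z}) := by
  have hMT : Disjoint M T := hM.mono_right Set.subset_union_left
  induction h with
  | @node B hB =>
    refine .node ?_
    have hcard : Z.ncard ≤ (B \ T).ncard + {z ∈ Z | Rch G M Z B z}.ncard := by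
      refine (hmin {v | Rch G M Z B v ∧ v ∉ Z} ?_ ?_).trans
        ((Set.ncard_le_ncard ?_).trans (Set.ncard_union_le _ _))
      · exact fun m hm => ⟨.base hm (Set.disjoint_right.1 hA hm),
          fun hz => Set.disjoint_left.1 hM hm (.inr hz)⟩
      · rw [Set.disjoint_left]
        rintro v ⟨hv, hvZ⟩ (hvT | hvZ')
        · exact hv.notMem_of_closed hT hMT hvT
        · exact hvZ hvZ'
      · rintro v ⟨hv, r, ⟨hr, hrZ⟩, hrv⟩
        by_cases hvB : v ∈ B
        · refine .inl ⟨hvB, fun hvT => ?_⟩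
          exact (hT v hvT r hrv.symm).elim (hr.notMem_of_closed hT hMT) hrZ
        · have : Rch G M Z B v := hr.step hrZ hrv hvB
          exact .inr ⟨by_contra fun hvZ => hv ⟨this, hvZ⟩, this⟩
    have hZ : {z ∈ Z | Rch G M Z B z}.ncard + {z ∈ Z | ¬ Rch G M Z B z}.ncard = Z.ncard := by
      rw [← Set.ncard_union_eq (Set.disjoint_left.2 fun x hx hx' => hx'.2 hx.2)]
      congr 1
      ext x
      by_cases hx : Rch G M Z B x <;> simp [hx]
    have hBT := Set.ncard_inter_add_ncard_sdiff_eq_ncard B T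
    have := Set.ncard_union_le (B ∩ T) {z ∈ Z | ¬ Rch G M Z B z}
    lia
  | @leaf B A C h hC hd hb ih =>
    have hcl := (h.leaf hC hd hb).closed
    have hleaf := (ih (hA.mono_left Set.subset_union_left)).leaf (C := C ∩ T)
      (hS C hC _ Set.inter_subset_left) ?_ ?_
    · convert hleaf using 1
      ext x
      simp only [Set.mem_union, Set.mem_inter_iff, Set.mem_ofPred_eq]
      tauto
    · rw [Set.disjoint_left]
      rintro x ⟨hxC, hxT⟩ (hx | hx)
      · exact Set.disjoint_left.1 hd hxC hx.1
      · exact Set.disjoint_left.1 hZT hx.1 hxT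
    · rintro v ⟨hv, c, ⟨hcC, hcT⟩, hcv⟩
      have hvC := mem_or_mem_bdry hcC hcv
      rcases hT c hcT v hcv with hvT | hvZ
      · exact .inl ⟨hb (hvC.resolve_left fun h1 => hv ⟨h1, hvT⟩), hvT⟩
      · refine .inr ⟨hvZ, fun hr => ?_⟩
        exact hr.notMem_of_disjoint hcl hA (hvC.symm.imp_left fun h1 => h.subset (hb h1))
  | @attach B A B' A' h h' hi hc he ih ih' =>
    have hcl := (h.attach h' hi hc he).closed
    have hR : ∀ v, Rch G M Z B v → v ∉ A ∪ A' := fun v hv => hv.notMem_of_disjoint hcl hA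
    have hRR : ∀ v, Rch G M Z B v → Rch G M Z B' v := fun v hv =>
      hv.mono fun w hw hwB => hR w hw (.inr (h'.subset hwB))
    have hatt := (ih (hA.mono_left Set.subset_union_left)).attach
      (ih' (hA.mono_left Set.subset_union_right)) ?_ ?_ ?_
    · convert hatt using 1
      ext x
      have hx : x ∈ {z ∈ Z | ¬ Rch G M Z B' z} → x ∈ {z ∈ Z | ¬ Rch G M Z B z} :=
        fun h1 => ⟨h1.1, fun h2 => h1.2 (hRR x h2)⟩
      simp only [Set.mem_union, Set.mem_inter_iff]
      clear * - hx
      tauto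
    · rintro x ⟨hx | hx, hx' | hx'⟩
      · exact ⟨.inl ⟨(hi ⟨hx.1, hx'.1⟩).1, hx.2⟩, .inl ⟨(hi ⟨hx.1, hx'.1⟩).2, hx.2⟩⟩
      · exact absurd hx.2 (Set.disjoint_left.1 hZT hx'.1)
      · exact absurd hx'.2 (Set.disjoint_left.1 hZT hx.1)
      · exact ⟨.inr hx, .inr hx'⟩
    · rintro a (ha | ha) haB v hav
      · have haB' : a ∉ B := fun h1 => haB (.inl ⟨h1, ha.2⟩)
        have hvA := hc a ha.1 haB' v hav
        rcases hT a ha.2 v hav with hvT | hvZ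
        · exact hvA.imp (fun h1 => .inl ⟨h1, hvT⟩) fun h1 => .inl ⟨h1, hvT⟩
        · exact .inl (.inr ⟨hvZ, fun hr => hR v hr hvA⟩)
      · exact absurd (.inr ⟨ha.1, fun hr => ha.2 (hRR a hr)⟩) haB
    · rintro u hu v (hv | hv) huv
      · rcases hu with hu | hu
        · exact (he u hu.1 v hv.1 huv).imp (fun h1 => .inl ⟨h1, hu.2⟩) fun h1 => .inl ⟨h1, hv.2⟩
        · by_cases hvA : v ∈ A
          · exact .inr (.inl ⟨hvA, hv.2⟩)
          · refine .inl (.inr ⟨hu.1, fun hr => ?_⟩)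
            have huA' : u ∉ A' := hr.notMem_of_disjoint h'.closed
              (hA.mono_left Set.subset_union_right)
            rcases hc v hv.1 (fun h1 => hvA (h.subset h1)) u huv.symm with h1 | h1
            · exact (he u h1 v hv.1 huv).elim huA' hvA
            · exact huA' h1
      · exact .inr (.inr ⟨hv.1, fun hr => hv.2 (hRR v hr)⟩)

lemma RD.shift_compl [Finite V] {k : ℕ} {M Z T : Set V} (hS : ∀ S ∈ 𝓢, ∀ S' ⊆ S, S' ∈ 𝓢)
    (hZT : Disjoint Z T) (hT : ∀ t ∈ T, ∀ v, G.Adj t v → v ∈ T ∪ Z) (hM : Disjoint M (T ∪ Z))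
    (hmin : ∀ R, M ⊆ R → Disjoint R (T ∪ Z) → Z.ncard ≤ (bdry G R).ncard)
    (h : RD G (fun B => B.ncard ≤ k) 𝓢 B Mᶜ) :
    ∃ B', Z ⊆ B' ∧ RD G (fun B => B.ncard ≤ k) 𝓢 B' (T ∪ Z) := by
  have hsh := h.shift hS hZT hT hM hmin disjoint_compl_left
  have hZ : {z ∈ Z | ¬ Rch G M Z B z} = Z := by
    refine Set.sep_eq_self_iff_mem_true.2 fun z hz hr => ?_
    have := hr.notMem_of_disjoint h.closed disjoint_compl_left
    exact Set.disjoint_left.1 hM (not_not.1 this) (.inr hz)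
  have hTM : Mᶜ ∩ T = T := Set.inter_eq_right.2 fun t ht hm => Set.disjoint_left.1 hM hm (.inl ht)
  rw [hZ, hTM] at hsh
  exact ⟨_, Set.subset_union_right, hsh⟩

/-- If `G` has no tree-decomposition into parts of size at most `k`, there is a bramble that is not
covered by any set of size at most `k`. -/
theorem exists_bramble [Finite V] {k : ℕ}
    (hno : ¬ ∃ B, RD G (fun B => B.ncard ≤ k) {∅} B Set.univ) :
    ∃ 𝓑, IsBramble G 𝓑 ∧ ∀ X : Set V, X.ncard ≤ k → ∃ S ∈ 𝓑, Disjoint X S := by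
  let F : Set (Set (Set V)) := {𝓢 | ∅ ∈ 𝓢 ∧ (∀ S ∈ 𝓢, ∀ S' ⊆ S, S' ∈ 𝓢) ∧
    ¬ ∃ B, RD G (fun B => B.ncard ≤ k) 𝓢 B Set.univ}
  have hF : {∅} ∈ F := by
    refine ⟨rfl, ?_, hno⟩
    rintro _ rfl S' hS'
    exact Set.subset_empty_iff.1 hS'
  obtain ⟨𝓢, -, ⟨hemp, hlow, hnoS⟩, hmax⟩ := (Set.toFinite F).exists_le_maximal hF
  have key : ∀ M, Minimal (· ∉ 𝓢) M → M.Nonempty ∧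
      ∃ B₁, RD G (fun B => B.ncard ≤ k) 𝓢 B₁ Mᶜ ∧ bdry G M ⊆ B₁ := by
    intro M hM
    have hne : M.Nonempty := by
      rw [Set.nonempty_iff_ne_empty]
      rintro rfl
      exact hM.1 hemp
    refine ⟨hne, ?_⟩
    have : ∃ B, RD G (fun B => B.ncard ≤ k) (insert M 𝓢) B Set.univ := by
      by_contra hcon
      refine hM.1 (hmax (y := insert M 𝓢) ⟨.inr hemp, ?_, hcon⟩ (Set.subset_insert M 𝓢)
        (Set.mem_insert _ _))
      rintro S (rfl | hS) S' hS'
      · by_contra hS'𝓢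
        refine hS'𝓢 (.inl (hS'.antisymm (hM.2 (fun h => hS'𝓢 (.inr h)) hS')))
      · exact .inr (hlow S hS S' hS')
    obtain ⟨B, hB⟩ := this
    rcases hB.reroot hne with h | ⟨-, -, h⟩
    · exact absurd ⟨B, h⟩ hnoS
    · exact h B (.node hB.root) Set.inter_subset_right (Set.univ_union B)
  have hconn : ∀ M, Minimal (· ∉ 𝓢) M → IsConnSet G M := by
    intro M hM
    obtain ⟨⟨m, hm⟩, B₁, hB₁, hbd⟩ := key M hM
    by_contra hcon
    have hK : comp G M m ⊆ M := comp_subset hm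
    have hKM : comp G M m ≠ M := fun h => hcon (h ▸ isConnSet_comp m)
    have hK𝓢 : comp G M m ∈ 𝓢 := by
      by_contra h
      exact hKM (hK.antisymm (hM.2 h hK))
    have hL𝓢 : M \ comp G M m ∈ 𝓢 := by
      by_contra h
      exact (hM.2 h Set.sdiff_subset hm).2 (mem_comp_self m)
    have h1 := hB₁.leaf hK𝓢 (Set.disjoint_left.2 fun x hx hx' => hx' (hK hx))
      fun v hv => hbd ⟨bdry_comp_subset hm hv, hv.2.imp fun c hc => ⟨hK hc.1, hc.2⟩⟩
    refine hnoS ⟨B₁, ?_⟩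
    have h2 := h1.leaf hL𝓢 ?_ ?_
    · convert h2
      ext x
      have := @hK x
      simp only [Set.mem_univ, Set.mem_union, Set.mem_compl_iff, Set.mem_sdiff, true_iff]
      tauto
    · exact Set.disjoint_left.2 fun x hx hx' => hx'.elim (fun h => h hx.1) hx.2
    · rintro v ⟨hv, c, hc, hcv⟩
      refine hbd ⟨fun hvM => hv ⟨hvM, fun hvK => hc.2 ?_⟩, c, hc.1, hcv⟩
      exact comp_closed hm hvK hcv.symm hc.1
  refine ⟨{M | Minimal (· ∉ 𝓢) M}, ⟨hconn, fun M₁ hM₁ M₂ hM₂ => ?_⟩, fun X hX => ?_⟩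
  · by_cases ht : ∃ u ∈ M₁, ∃ v ∈ M₂, u = v ∨ G.Adj u v
    · obtain ⟨u, hu, v, hv, huv⟩ := ht
      have hlink : LinkedIn G (M₁ ∪ M₂) u v := by
        rcases huv with rfl | huv
        · rfl
        · exact .of_adj huv (.inl hu) (.inr hv)
      refine isConnSet_of_linkedIn (.inl hu) ?_
      rintro y (hy | hy)
      · exact ((hconn M₁ hM₁).linkedIn hu hy).mono_set Set.subset_union_left
      · exact hlink.trans (((hconn M₂ hM₂).linkedIn hv hy).mono_set Set.subset_union_right)
    · exfalso
      push Not at ht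
      obtain ⟨R, ⟨hMR, hRd⟩, hRmin⟩ := Set.exists_min_image
        {R : Set V | M₁ ⊆ R ∧ Disjoint (R ∪ bdry G R) M₂} (fun R => (bdry G R).ncard)
        (Set.toFinite _) ⟨M₁, subset_rfl, by
          rw [Set.disjoint_left]
          rintro x (hx | ⟨-, c, hc, hcx⟩) hx₂
          · exact (ht x hx x hx₂).1 rfl
          · exact (ht c hc x hx₂).2 hcx⟩
      have hRnb : ∀ t ∈ R, ∀ v, G.Adj t v → v ∈ R ∪ bdry G R := fun t ht v htv =>
        mem_or_mem_bdry ht htv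
      obtain ⟨-, B₁, hB₁, -⟩ := key M₁ hM₁
      obtain ⟨-, B₂, hB₂, -⟩ := key M₂ hM₂
      have hTnb : ∀ t ∈ (R ∪ bdry G R)ᶜ, ∀ v, G.Adj t v → v ∈ (R ∪ bdry G R)ᶜ ∪ bdry G R := by
        intro t ht v htv
        by_contra hv
        have hvR : v ∈ R := by
          simp only [Set.mem_union, Set.mem_compl_iff] at hv
          tauto
        exact ht (hRnb v hvR t htv.symm)
      obtain ⟨C₁, hZC₁, hC₁⟩ := hB₁.shift_compl (Z := bdry G R) (T := (R ∪ bdry G R)ᶜ) hlow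
        (Set.disjoint_left.2 fun x hx hx' => hx' (.inr hx)) hTnb
        (Set.disjoint_left.2 fun x hx hx' => hx'.elim (fun h => h (.inl (hMR hx)))
          fun h => h.1 (hMR hx))
        (fun R' hR' hd' => hRmin R' ⟨hR', by
          rw [Set.disjoint_left]
          have hM₂T : ∀ x ∈ M₂, x ∈ (R ∪ bdry G R)ᶜ := fun x hx h =>
            Set.disjoint_left.1 hRd h hx
          rintro x (hx | ⟨-, c, hc, hcx⟩) hx₂
          · exact Set.disjoint_left.1 hd' hx (.inl (hM₂T x hx₂))
          · exact Set.disjoint_left.1 hd' hc (hTnb x (hM₂T x hx₂) c hcx.symm)⟩)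
      obtain ⟨C₂, hZC₂, hC₂⟩ := hB₂.shift_compl (Z := bdry G R) (T := R) hlow
        disjoint_bdry.symm hRnb hRd.symm
        (fun R' hR' hd' => by
          have hsub : bdry G (R' ∪ bdry G R')ᶜ ⊆ bdry G R' := by
            rintro v ⟨hv, c, hc, hcv⟩
            rcases not_not.1 hv with h | h
            · exact absurd (mem_or_mem_bdry h hcv.symm) hc
            · exact h
          refine (hRmin (R' ∪ bdry G R')ᶜ ⟨?_, ?_⟩).trans (Set.ncard_le_ncard hsub)
          · rintro m hm (hmR' | ⟨-, c, hc, hcm⟩)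
            · exact Set.disjoint_left.1 hd' hmR' (.inl (hMR hm))
            · exact Set.disjoint_left.1 hd' hc (hRnb m (hMR hm) c hcm.symm)
          · rw [Set.disjoint_left]
            rintro x (hx | hx) hx₂
            · exact hx (.inl (hR' hx₂))
            · exact (hsub hx).1 (hR' hx₂))
      refine hnoS ⟨C₁, ?_⟩
      have huniv : (R ∪ bdry G R)ᶜ ∪ bdry G R ∪ (R ∪ bdry G R) = Set.univ := by
        ext x
        simp only [Set.mem_union, Set.mem_compl_iff, Set.mem_univ, iff_true]
        tauto
      rw [← huniv]
      refine hC₁.attach hC₂ ?_ ?_ ?_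
      · rintro x ⟨hx | hx, hx'⟩
        · exact absurd hx' hx
        · exact ⟨hZC₁ hx, hZC₂ hx⟩
      · exact fun a _ _ v _ => huniv ▸ Set.mem_univ v
      · rintro u hu v (hv | hv) huv
        · exact .inl (hRnb v hv u huv.symm)
        · exact .inr (.inr hv)
  · by_contra! hcon
    by_cases hXc : Xᶜ ∈ 𝓢
    · refine hnoS ⟨X, ?_⟩
      rw [← Set.union_compl_self X]
      exact (RD.node hX).leaf hXc disjoint_compl_left fun v hv => not_not.1 hv.1
    · obtain ⟨M, hMX, hM⟩ := (Set.toFinite {S | S ∉ 𝓢}).exists_le_minimal hXc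
      exact hcon M hM (Set.disjoint_left.2 fun x hx hxM => hMX hxM hx)

lemma exists_rd [Finite V] :
    ∃ B, RD G (fun B => B.ncard ≤ cbn G) {∅} B Set.univ := by
  by_contra hcon
  obtain ⟨𝓑, hb, hcov⟩ := exists_bramble hcon
  have : cbn G + 1 ≤ cbn G := by
    refine le_cbn hb ?_ fun X hX => ?_
    · obtain ⟨S, hS, -⟩ := hcov ∅ (by simp)
      exact ⟨S, hS⟩
    · by_contra hlt
      obtain ⟨S, hS, hd⟩ := hcov X (by lia)
      exact Set.not_disjoint_iff_nonempty_inter.2 (hX.2 S hS) hd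
  lia

end

section

variable {V : Type u} {G H H' : SimpleGraph V} {k : ℕ} {U Y K M D : Set V}

/-- `CD H k U` says that `H[U]` arises from complete graphs of order at most `k` by glueing along
cliques. -/
inductive CD (H : SimpleGraph V) (k : ℕ) : Set V → Prop
  | clique {U : Set V} : H.IsClique U → U.ncard ≤ k → CD H k U
  | glue {U₁ U₂ : Set V} : CD H k U₁ → CD H k U₂ → H.IsClique (U₁ ∩ U₂) →
      (∀ u ∈ U₁ \ U₂, ∀ v ∈ U₂ \ U₁, ¬ H.Adj u v) → CD H k (U₁ ∪ U₂)

namespace CD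

lemma congr (h : CD H k U) (hH : ∀ u ∈ U, ∀ v ∈ U, H.Adj u v ↔ H'.Adj u v) : CD H' k U := by
  induction h with
  | clique hU hk => exact .clique (fun u hu v hv huv => (hH u hu v hv).1 (hU hu hv huv)) hk
  | glue h₁ h₂ hi hc ih₁ ih₂ =>
    refine .glue (ih₁ fun u hu v hv => hH u (.inl hu) v (.inl hv))
      (ih₂ fun u hu v hv => hH u (.inr hu) v (.inr hv)) ?_ ?_
    · exact fun u hu v hv huv => (hH u (.inl hu.1) v (.inl hv.1)).1 (hi hu hv huv)
    · exact fun u hu v hv huv => hc u hu v hv ((hH u (.inl hu.1) v (.inr hv.1)).2 huv)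

lemma inter [Finite V] (h : CD H k U) (Y : Set V) : CD H k (U ∩ Y) := by
  induction h with
  | clique hU hk =>
    exact .clique (hU.subset Set.inter_subset_left)
      ((Set.ncard_le_ncard Set.inter_subset_left).trans hk)
  | @glue U₁ U₂ h₁ h₂ hi hc ih₁ ih₂ =>
    rw [Set.union_inter_distrib_right]
    refine .glue ih₁ ih₂ (hi.subset ?_) ?_
    · exact fun x hx => ⟨hx.1.1, hx.2.1⟩
    rintro u ⟨⟨hu, huY⟩, hu₂⟩ v ⟨⟨hv, hvY⟩, hv₁⟩
    exact hc u ⟨hu, fun h => hu₂ ⟨h, huY⟩⟩ v ⟨hv, fun h => hv₁ ⟨h, hvY⟩⟩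

lemma subset_or_subset {U₁ U₂ : Set V} (hc : ∀ u ∈ U₁ \ U₂, ∀ v ∈ U₂ \ U₁, ¬ H.Adj u v)
    (hK : H.IsClique K) (hKU : K ⊆ U₁ ∪ U₂) : K ⊆ U₁ ∨ K ⊆ U₂ := by
  by_contra! hcon
  obtain ⟨u, hu, hu₁⟩ := Set.not_subset.1 hcon.1
  obtain ⟨v, hv, hv₂⟩ := Set.not_subset.1 hcon.2
  have hu₂ := (hKU hu).resolve_left hu₁
  have hv₁ := (hKU hv).resolve_right hv₂
  refine hc v ⟨hv₁, hv₂⟩ u ⟨hu₂, hu₁⟩ (hK hv hu ?_)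
  rintro rfl
  exact hu₁ hv₁

lemma ncard_le [Finite V] (h : CD H k U) (hK : H.IsClique K) (hKU : K ⊆ U) : K.ncard ≤ k := by
  induction h with
  | clique hU hk => exact (Set.ncard_le_ncard hKU).trans hk
  | glue h₁ h₂ hi hc ih₁ ih₂ => exact (subset_or_subset hc hK hKU).elim ih₁ ih₂

end CD

/-- Filling in the parts of a tree-decomposition gives a chordal supergraph. -/
lemma RD.exists_chordal {A B : Set V} (h : RD G (fun B => B.ncard ≤ k) {∅} B A) :
    ∃ H : SimpleGraph V, (∀ u v, H.Adj u v → u ∈ A ∧ v ∈ A) ∧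
      (∀ u ∈ A, ∀ v ∈ A, G.Adj u v → H.Adj u v) ∧ H.IsClique B ∧ CD H k A := by
  induction h with
  | @node B hB =>
    let H : SimpleGraph V :=
      { Adj := fun u v => u ≠ v ∧ u ∈ B ∧ v ∈ B
        symm := ⟨fun _ _ h => ⟨h.1.symm, h.2.2, h.2.1⟩⟩
        loopless := ⟨fun _ h => h.1 rfl⟩ }
    have hH : H.IsClique B := fun u hu v hv huv => ⟨huv, hu, hv⟩
    exact ⟨H, fun _ _ h => h.2, fun u hu v hv huv => ⟨huv.ne, hu, hv⟩, hH, .clique hH hB⟩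
  | leaf h hC _ _ ih =>
    rw [Set.mem_singleton_iff.1 hC, Set.union_empty]
    exact ih
  | @attach B A B' A' h h' hi hc he ih ih' =>
    obtain ⟨H, hHA, hGH, hHB, hH⟩ := ih
    obtain ⟨H', hHA', hGH', hHB', hH'⟩ := ih'
    refine ⟨H ⊔ H', ?_, ?_, hHB.mono le_sup_left, ?_⟩
    · rintro u v (huv | huv)
      · exact ⟨.inl (hHA u v huv).1, .inl (hHA u v huv).2⟩
      · exact ⟨.inr (hHA' u v huv).1, .inr (hHA' u v huv).2⟩
    · have key : ∀ u ∈ A, ∀ v ∈ A', G.Adj u v → (H ⊔ H').Adj u v := fun u hu v hv huv =>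
        (he u hu v hv huv).elim (fun h => .inr (hGH' u h v hv huv))
          fun h => .inl (hGH u hu v h huv)
      rintro u (hu | hu) v (hv | hv) huv
      · exact .inl (hGH u hu v hv huv)
      · exact key u hu v hv huv
      · exact (key v hv u hu huv.symm).symm
      · exact .inr (hGH' u hu v hv huv)
    · refine .glue (hH.congr fun u hu v hv => ⟨.inl, fun h => h.elim id fun h => ?_⟩)
        (hH'.congr fun u hu v hv => ⟨.inr, fun h => h.elim (fun h => ?_) id⟩) ?_ ?_
      · have := hHA' u v h
        exact hHB (hi ⟨hu, this.1⟩).1 (hi ⟨hv, this.2⟩).1 h.ne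
      · have := hHA u v h
        exact hHB' (hi ⟨this.1, hu⟩).2 (hi ⟨this.2, hv⟩).2 h.ne
      · exact (hHB.subset fun x hx => (hi hx).1).mono le_sup_left
      · rintro u hu v hv (h | h)
        · exact hv.2 (hHA u v h).2
        · exact hu.2 (hHA' u v h).1

/-- `H` is a minimal chordal supergraph of `G` of clique number at most `k`. -/
def IsMinChordal (G : SimpleGraph V) (k : ℕ) (H : SimpleGraph V) : Prop :=
  Minimal (fun H => G ≤ H ∧ CD H k Set.univ) H

lemma exists_isMinChordal [Finite V] (G : SimpleGraph V) : ∃ H, IsMinChordal G (cbn G) H := by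
  obtain ⟨B, hB⟩ := exists_rd (G := G)
  obtain ⟨H, -, hGH, -, hH⟩ := hB.exists_chordal
  obtain ⟨K, -, hK⟩ := (Set.toFinite {H | G ≤ H ∧ CD H (cbn G) Set.univ}).exists_le_minimal
    (a := H) ⟨fun u v h => hGH u trivial v trivial h, hH⟩
  exact ⟨K, hK⟩

/-- If a connected set meets one side of a clique separation, its trace there is connected. -/
lemma linkedIn_inter_of_glue {U₁ U₂ : Set V} (hi : H.IsClique (U₁ ∩ U₂))
    (hc : ∀ u ∈ U₁ \ U₂, ∀ v ∈ U₂ \ U₁, ¬ H.Adj u v) (hDU : D ⊆ U₁ ∪ U₂) {x v : V}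
    (hx : x ∈ D ∩ U₁) (h : LinkedIn H D x v) :
    (v ∈ U₁ → LinkedIn H (D ∩ U₁) x v) ∧
      (v ∉ U₁ → ∃ w ∈ D ∩ U₁ ∩ U₂, LinkedIn H (D ∩ U₁) x w) := by
  induction h with
  | refl => exact ⟨fun _ => .refl _, fun h => absurd hx.2 h⟩
  | @tail b c _ hbc ih =>
    obtain ⟨hbc, hb, hc'⟩ := hbc
    by_cases hb₁ : b ∈ U₁
    · refine ⟨fun hc₁ => (ih.1 hb₁).trans (.of_adj hbc ⟨hb, hb₁⟩ ⟨hc', hc₁⟩), fun hc₁ => ?_⟩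
      have hc₂ := (hDU hc').resolve_left hc₁
      refine ⟨b, ⟨⟨hb, hb₁⟩, ?_⟩, ih.1 hb₁⟩
      by_contra hb₂
      exact hc b ⟨hb₁, hb₂⟩ c ⟨hc₂, hc₁⟩ hbc
    · obtain ⟨w, hw, hxw⟩ := ih.2 hb₁
      refine ⟨fun hc₁ => ?_, fun _ => ⟨w, hw, hxw⟩⟩
      have hb₂ := (hDU hb).resolve_left hb₁
      have hc₂ : c ∈ U₂ := by
        by_contra hc₂
        exact hc c ⟨hc₁, hc₂⟩ b ⟨hb₂, hb₁⟩ hbc.symm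
      by_cases hwc : w = c
      · exact hwc ▸ hxw
      · exact hxw.trans (.of_adj (hi ⟨hw.1.2, hw.2⟩ ⟨hc₁, hc₂⟩ hwc) hw.1 ⟨hc', hc₁⟩)

/-- In a chordal graph, a connected set to which every vertex of a clique sends an edge contains a
common neighbour of that clique. -/
lemma CD.exists_common_adj {S : Set V} (h : CD H k U) (hDU : D ⊆ U) (hD : IsConnSet H D)
    (hSU : S ⊆ U) (hS : H.IsClique S) (hSD : Disjoint S D) (hadj : ∀ s ∈ S, ∃ d ∈ D, H.Adj s d) :
    ∃ c ∈ D, ∀ s ∈ S, H.Adj s c := by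
  induction h generalizing D with
  | clique hU hk =>
    obtain ⟨c, hc⟩ := hD.1
    refine ⟨c, hc, fun s hs => hU (hSU hs) (hDU hc) ?_⟩
    rintro rfl
    exact Set.disjoint_left.1 hSD hs hc
  | @glue U₁ U₂ h₁ h₂ hi hc ih₁ ih₂ =>
    have step : ∀ {W₁ W₂ : Set V}, H.IsClique (W₁ ∩ W₂) →
        (∀ u ∈ W₁ \ W₂, ∀ v ∈ W₂ \ W₁, ¬ H.Adj u v) → D ⊆ W₁ ∪ W₂ → S ⊆ W₁ →
        (∀ {D : Set V}, D ⊆ W₁ → IsConnSet H D → S ⊆ W₁ → Disjoint S D →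
          (∀ s ∈ S, ∃ d ∈ D, H.Adj s d) → ∃ c ∈ D, ∀ s ∈ S, H.Adj s c) →
        (∀ {D : Set V}, D ⊆ W₂ → IsConnSet H D → S ⊆ W₂ → Disjoint S D →
          (∀ s ∈ S, ∃ d ∈ D, H.Adj s d) → ∃ c ∈ D, ∀ s ∈ S, H.Adj s c) →
        ∃ c ∈ D, ∀ s ∈ S, H.Adj s c := by
      intro W₁ W₂ hi hc hDW hSW ih₁ ih₂
      by_cases hne : ∃ x, x ∈ D ∩ W₁
      · obtain ⟨x, hx⟩ := hne
        obtain ⟨c, hc', h⟩ := ih₁ (D := D ∩ W₁) Set.inter_subset_right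
          (isConnSet_of_linkedIn hx fun y hy =>
            (linkedIn_inter_of_glue hi hc hDW hx (hD.linkedIn hx.1 hy.1)).1 hy.2)
          hSW (hSD.mono_right Set.inter_subset_left) (fun s hs => by
            obtain ⟨d, hd, hsd⟩ := hadj s hs
            by_cases hdW : d ∈ W₁
            · exact ⟨d, ⟨hd, hdW⟩, hsd⟩
            · obtain ⟨w, hw, -⟩ :=
                (linkedIn_inter_of_glue hi hc hDW hx (hD.linkedIn hx.1 hd)).2 hdW
              have hs₂ : s ∈ W₂ := by
                by_contra hs₂
                exact hc s ⟨hSW hs, hs₂⟩ d ⟨(hDW hd).resolve_left hdW, hdW⟩ hsd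
              refine ⟨w, hw.1, hi ⟨hSW hs, hs₂⟩ ⟨hw.1.2, hw.2⟩ ?_⟩
              rintro rfl
              exact Set.disjoint_left.1 hSD hs hw.1.1)
        exact ⟨c, hc'.1, h⟩
      · have hDW₂ : ∀ d ∈ D, d ∈ W₂ \ W₁ := fun d hd =>
          ⟨(hDW hd).resolve_left fun h => hne ⟨d, hd, h⟩, fun h => hne ⟨d, hd, h⟩⟩
        refine ih₂ (fun d hd => (hDW₂ d hd).1) hD (fun s hs => ?_) hSD hadj
        obtain ⟨d, hd, hsd⟩ := hadj s hs
        by_contra hs₂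
        exact hc s ⟨hSW hs, hs₂⟩ d (hDW₂ d hd) hsd
    rcases subset_or_subset hc hS hSU with h | h
    · exact step hi hc hDU h (fun h1 h2 h3 h4 h5 => ih₁ h1 h2 h3 h4 h5)
        fun h1 h2 h3 h4 h5 => ih₂ h1 h2 h3 h4 h5
    · refine step (Set.inter_comm U₁ U₂ ▸ hi) (fun u hu v hv huv => hc v hv u hu huv.symm)
        (Set.union_comm U₁ U₂ ▸ hDU) h (fun h1 h2 h3 h4 h5 => ih₂ h1 h2 h3 h4 h5)
        fun h1 h2 h3 h4 h5 => ih₁ h1 h2 h3 h4 h5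

/-- A minimal chordal supergraph has no edge across a clique separation of the original graph. -/
lemma IsMinChordal.not_adj [Finite V] (hH : IsMinChordal G k H) {X Y : Set V}
    (hXY : X ∪ Y = Set.univ) (hcl : H.IsClique (X ∩ Y))
    (hG : ∀ u ∈ X \ Y, ∀ v ∈ Y \ X, ¬ G.Adj u v) :
    ∀ u ∈ X \ Y, ∀ v ∈ Y \ X, ¬ H.Adj u v := by
  let H' : SimpleGraph V :=
    { Adj := fun u v => H.Adj u v ∧ (u ∈ X ∧ v ∈ X ∨ u ∈ Y ∧ v ∈ Y)
      symm := ⟨fun _ _ h => ⟨h.1.symm, h.2.imp And.symm And.symm⟩⟩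
      loopless := ⟨fun _ h => h.1.ne rfl⟩ }
  have hmem : ∀ x, x ∈ X ∨ x ∈ Y := fun x => (hXY ▸ Set.mem_univ x : x ∈ X ∪ Y)
  have hGH : G ≤ H' := by
    intro u v huv
    refine ⟨hH.1.1 huv, ?_⟩
    by_contra hcon
    have hu := hmem u
    have hv := hmem v
    by_cases huX : u ∈ X
    · exact hG u ⟨huX, by tauto⟩ v ⟨by tauto, by tauto⟩ huv
    · exact hG v ⟨by tauto, by tauto⟩ u ⟨by tauto, huX⟩ huv.symm
  have hX := hH.1.2.inter X
  have hY := hH.1.2.inter Y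
  rw [Set.univ_inter] at hX hY
  have hCD : CD H' k Set.univ := by
    rw [← hXY]
    refine .glue (hX.congr fun u hu v hv => ⟨fun h => ⟨h, .inl ⟨hu, hv⟩⟩, And.left⟩)
      (hY.congr fun u hu v hv => ⟨fun h => ⟨h, .inr ⟨hu, hv⟩⟩, And.left⟩) ?_ ?_
    · exact fun u hu v hv huv => ⟨hcl hu hv huv, .inl ⟨hu.1, hv.1⟩⟩
    · exact fun u hu v hv huv => huv.2.elim (fun h => hv.2 h.2) fun h => hu.2 h.1
  have hle : H ≤ H' := hH.2 ⟨hGH, hCD⟩ fun _ _ h => h.1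
  exact fun u hu v hv huv => (hle huv).2.elim (fun h => hv.2 h.2) fun h => hu.2 h.1

lemma IsMinChordal.bdry_subset [Finite V] (hH : IsMinChordal G k H)
    (hcl : H.IsClique (bdry G D)) : bdry H D ⊆ bdry G D := by
  rintro v ⟨hv, d, hd, hdv⟩
  by_contra hvN
  refine hH.not_adj (X := D ∪ bdry G D) (Y := Dᶜ) ?_ (hcl.subset ?_) ?_ d
    ⟨.inl hd, fun h => h hd⟩ v ⟨hv, fun h => h.elim hv hvN⟩ hdv
  · ext x
    simp only [Set.mem_union, Set.mem_compl_iff, Set.mem_univ, iff_true]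
    tauto
  · exact fun x hx => hx.1.resolve_left hx.2
  · rintro u ⟨-, hu⟩ v ⟨-, hv⟩ huv
    exact hv (mem_or_mem_bdry (not_not.1 hu) huv)

/-- The vertices of a maximal clique of a minimal chordal supergraph are linked outside any of the
components it leaves. -/
lemma IsMinChordal.linkedIn_compl [Finite V] (hH : IsMinChordal G k H) (hM : H.IsClique M)
    (hMmax : ∀ w, (∀ m ∈ M, H.Adj m w) → w ∈ M) (hD : IsConnSet G D) (hDM : Disjoint D M)
    (hbd : bdry G D ⊆ M) {m₁ m₂ : V} (hm₁ : m₁ ∈ M) (hm₂ : m₂ ∈ M) : LinkedIn G Dᶜ m₁ m₂ := by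
  obtain ⟨w, hw, hwN⟩ : ∃ w ∈ M, w ∉ bdry G D := by
    by_contra! hcon
    obtain ⟨c, hc, hcM⟩ := hH.1.2.exists_common_adj (S := bdry G D) (Set.subset_univ D)
      (isConnSet_iff.2 ⟨hD.1, fun x hx y hy => (hD.linkedIn hx hy).mono hH.1.1 subset_rfl⟩)
      (Set.subset_univ _) (hM.subset hbd) disjoint_bdry.symm
      fun s hs => hs.2.imp fun d hd => ⟨hd.1, hH.1.1 hd.2.symm⟩
    exact Set.disjoint_left.1 hDM hc (hMmax c fun m hm => hcM m (hcon m hm))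
  have hMD : ∀ m ∈ M, m ∈ Dᶜ := fun m hm h => Set.disjoint_left.1 hDM h hm
  set K := comp G Dᶜ m₁ with hK
  have hKD : K ⊆ Dᶜ := comp_subset (hMD m₁ hm₁)
  have hKcl : ∀ a ∈ K, ∀ b, G.Adj a b → b ∉ D → b ∈ K := fun a ha b hab hb =>
    comp_closed (hMD m₁ hm₁) ha hab hb
  by_contra hcon
  have hm₂K : m₂ ∉ K := hcon
  have hm₁K : m₁ ∈ K := mem_comp_self m₁
  have hne : m₁ ≠ m₂ := by
    rintro rfl
    exact hm₂K hm₁K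
  by_cases hwK : w ∈ K
  · refine hH.not_adj (X := K) (Y := D ∪ bdry G D ∪ Kᶜ) ?_ (hM.subset ?_) ?_ w ⟨hwK, ?_⟩ m₂
      ⟨.inr hm₂K, hm₂K⟩ (hM hw hm₂ ?_)
    · ext x
      simp only [Set.mem_union, Set.mem_compl_iff, Set.mem_univ, iff_true]
      tauto
    · rintro x ⟨hxK, (hx | hx) | hx⟩
      · exact absurd hx (hKD hxK)
      · exact hbd hx
      · exact absurd hxK hx
    · rintro a ⟨haK, ha⟩ b ⟨-, hbK⟩ hab
      have hb : b ∈ D := by_contra fun hb => hbK (hKcl a haK b hab hb)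
      exact ha (.inl (mem_or_mem_bdry hb hab.symm))
    · rintro ((h | h) | h)
      · exact hKD hwK h
      · exact hwN h
      · exact h hwK
    · rintro rfl
      exact hm₂K hwK
  · refine hH.not_adj (X := D ∪ bdry G D ∪ K) (Y := Dᶜ \ K) ?_ (hM.subset ?_) ?_ m₁ ⟨.inr hm₁K, ?_⟩
      w ⟨⟨hMD w hw, hwK⟩, ?_⟩ (hM hm₁ hw ?_)
    · ext x
      simp only [Set.mem_union, Set.mem_compl_iff, Set.mem_univ, iff_true, Set.mem_sdiff]
      tauto
    · rintro x ⟨(hx | hx) | hx, hxD, hxK⟩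
      · exact absurd hx hxD
      · exact hbd hx
      · exact absurd hx hxK
    · rintro a ⟨-, ha⟩ b ⟨⟨hbD, hbK⟩, hb⟩ hab
      by_cases haD : a ∈ D
      · exact hb (.inl (mem_or_mem_bdry haD hab))
      · have haK : a ∈ K := by_contra fun h => ha ⟨haD, h⟩
        exact hbK (hKcl a haK b hab hbD)
    · exact fun h => h.2 hm₁K
    · rintro ((h | h) | h)
      · exact hMD w hw h
      · exact hwN h
      · exact hwK h
    · rintro rfl
      exact hwK hm₁K

end

section

variable {V : Type u} {G : SimpleGraph V} {φ : V → V → ZMod 2} {u v w : V}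

/-- The sum of the labels of the edges of a walk. -/
def wt (φ : V → V → ZMod 2) : ∀ {u v : V}, G.Walk u v → ZMod 2
  | _, _, .nil => 0
  | u, _, .cons (v := v) _ p => φ u v + wt φ p

@[simp] lemma wt_nil : wt φ (.nil : G.Walk u u) = 0 := rfl

@[simp] lemma wt_cons (h : G.Adj u v) (p : G.Walk v w) : wt φ (.cons h p) = φ u v + wt φ p := rfl

@[simp] lemma wt_append (p : G.Walk u v) (q : G.Walk v w) :
    wt φ (p.append q) = wt φ p + wt φ q := by
  induction p with
  | nil => simp
  | cons h p ih => simp [ih, add_assoc]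

lemma wt_reverse (hφ : ∀ u v, φ u v = φ v u) (p : G.Walk u v) : wt φ p.reverse = wt φ p := by
  induction p with
  | nil => simp
  | cons h p ih => simp [ih, hφ, add_comm]

lemma wt_eq_sum (p : G.Walk u v) :
    wt φ p = ∑ i ∈ Finset.range p.length, φ (p.getVert i) (p.getVert (i + 1)) := by
  induction p with
  | nil => simp
  | cons h p ih =>
    rw [wt_cons, Walk.length_cons, Finset.sum_range_succ', ih, add_comm]
    simp

lemma exists_path_wt_eq {X : Set V} [Finite V]
    (hL : ∀ (x : V) (c : G.Walk x x), (∀ y ∈ c.support, y ∈ X) → c.length ≤ X.ncard → wt φ c = 0)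
    (p : G.Walk u v) (hp : ∀ y ∈ p.support, y ∈ X) :
    ∃ q : G.Walk u v, (∀ y ∈ q.support, y ∈ X) ∧ q.IsPath ∧ wt φ q = wt φ p := by
  classical
  induction p with
  | nil => exact ⟨.nil, hp, by simp, rfl⟩
  | @cons a b c h p ih =>
    obtain ⟨q, hq, hqp, hw⟩ := ih fun y hy => hp y (by simp [hy])
    have ha : a ∈ X := hp a (by simp)
    by_cases haq : a ∈ q.support
    · refine ⟨q.dropUntil a haq, fun y hy => hq y (q.support_dropUntil_subset_support haq hy),
        hqp.dropUntil haq, ?_⟩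
      have hcl := hL a (.cons h (q.takeUntil a haq)) ?_ ?_
      · have hspec := congrArg (wt φ) (q.take_spec haq)
        rw [wt_append] at hspec
        rw [wt_cons] at hcl ⊢
        rw [← hw, ← hspec, ← add_assoc, hcl, zero_add]
      · intro y hy
        rw [Walk.support_cons, List.mem_cons] at hy
        rcases hy with rfl | hy
        · exact ha
        · exact hq y (q.support_takeUntil_subset_support haq hy)
      · have hnd := (hqp.takeUntil haq).support_nodup
        rw [Walk.length_cons, ← Walk.length_support, ← List.toFinset_card_of_nodup hnd,
          ← Set.ncard_coe_finset]
        refine Set.ncard_le_ncard fun y hy => ?_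
        exact hq y (q.support_takeUntil_subset_support haq (by simpa using hy))
    · refine ⟨.cons h q, fun y hy => ?_, hqp.cons haq, by simp [hw]⟩
      rw [Walk.support_cons, List.mem_cons] at hy
      rcases hy with rfl | hy
      · exact ha
      · exact hq y hy

lemma _root_.SimpleGraph.Walk.IsPath.length_lt_ncard [Finite V] {X : Set V} {p : G.Walk u v}
    (hp : p.IsPath) (hX : ∀ y ∈ p.support, y ∈ X) : p.length < X.ncard := by
  classical
  rw [← Nat.succ_le_iff, Nat.succ_eq_add_one, ← Walk.length_support,
    ← List.toFinset_card_of_nodup hp.support_nodup, ← Set.ncard_coe_finset]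
  exact Set.ncard_le_ncard fun y hy => hX y (by simpa using hy)

/-- A connected cover of all arcs of half the length of a shortest odd closed walk is large. -/
lemma half_length_lt_ncard [Finite V] (hφ : ∀ u v, φ u v = φ v u) {L : ℕ} (hL2 : 2 ≤ L)
    (hmin : ∀ (x : V) (c : G.Walk x x), c.length < L → wt φ c = 0) {s : ℕ → V} {f : ℕ → ZMod 2}
    (hs : ∀ i, s (i + L) = s i) (hf : ∀ i, f (i + L) = f i + 1)
    (hseg : ∀ i n, ∃ p : G.Walk (s i) (s (i + n)), p.length = n ∧ wt φ p = f i + f (i + n))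
    {X : Set V} (hX : IsConnSet G X) (hcov : ∀ i, ∃ j < L / 2, s (i + j) ∈ X) :
    (L + 1) / 2 + 1 ≤ X.ncard := by
  by_contra hlt
  have hpath : ∀ x ∈ X, ∀ y ∈ X, ∃ q : G.Walk x y, (∀ z ∈ q.support, z ∈ X) ∧
      q.length < X.ncard := by
    intro x hx y hy
    obtain ⟨p, hp⟩ := hX.2 x hx y hy
    classical
    have hsub : ∀ z ∈ p.bypass.support, z ∈ X := fun z hz => hp z (p.support_bypass_subset_support hz)
    exact ⟨p.bypass, hsub, p.bypass_isPath.length_lt_ncard hsub⟩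
  have hclosed : ∀ (x : V) (c : G.Walk x x), (∀ z ∈ c.support, z ∈ X) → wt φ c = 0 := by
    intro x c hc
    obtain ⟨q, -, hq, hw⟩ := exists_path_wt_eq (X := X) (φ := φ)
      (fun x c _ hl => hmin x c (by lia)) c hc
    rw [← hw, (Walk.isPath_iff_nil.1 hq).eq_nil]
    rfl
  obtain ⟨x₀, hx₀⟩ := hX.1
  choose! r hr hrl using hpath x₀ hx₀
  have hψ : ∀ x ∈ X, ∀ y ∈ X, ∀ q : G.Walk x y, (∀ z ∈ q.support, z ∈ X) →
      ∀ hx hy, wt φ q = wt φ (r x hx) + wt φ (r y hy) := by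
    intro x hx y hy q hq hx' hy'
    have := hclosed _ (((r x hx).append q).append (r y hy).reverse) (by
      intro z hz
      rw [Walk.mem_support_append_iff, Walk.mem_support_append_iff, Walk.support_reverse,
        List.mem_reverse] at hz
      rcases hz with (hz | hz) | hz
      · exact hr x hx z hz
      · exact hq z hz
      · exact hr y hy z hz)
    rw [wt_append, wt_append, wt_reverse hφ] at this
    generalize wt φ q = a at *
    generalize wt φ (r x hx) = b at *
    generalize wt φ (r y hy) = c at *
    revert a b c
    decide
  obtain ⟨j₀, -, hj₀⟩ := hcov 0
  rw [zero_add] at hj₀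
  have hg : ∀ n, ∀ hn : s n ∈ X, j₀ ≤ n →
      f n + wt φ (r (s n) hn) = f j₀ + wt φ (r (s j₀) hj₀) := by
    intro n
    induction n using Nat.strong_induction_on with
    | _ n ih =>
      intro hn hjn
      rcases hjn.eq_or_lt with rfl | hjn
      · rfl
      · obtain ⟨j, hjX, hj₀j, hjn', hnj⟩ : ∃ j, s j ∈ X ∧ j₀ ≤ j ∧ j < n ∧ n ≤ j + L / 2 := by
          by_cases hnm : n ≤ j₀ + L / 2
          · exact ⟨j₀, hj₀, le_rfl, hjn, hnm⟩
          · obtain ⟨i, hi, hiX⟩ := hcov (n - L / 2)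
            exact ⟨_, hiX, by lia, by lia, by lia⟩
        rw [← ih j hjn' hjX hj₀j]
        obtain ⟨d, rfl⟩ := Nat.exists_eq_add_of_le hjn'.le
        obtain ⟨p, hpl, hpw⟩ := hseg j d
        obtain ⟨q, hq, hql⟩ := hpath _ hn _ hjX
        have h1 := hmin _ (p.append q) (by rw [Walk.length_append]; lia)
        have h2 := hψ _ hn _ hjX q hq hn hjX
        rw [wt_append, hpw, h2] at h1
        generalize f j = a at *
        generalize f (j + d) = b at *
        generalize wt φ (r (s j) hjX) = c at *
        generalize wt φ (r (s (j + d)) hn) = e at *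
        clear * - h1
        revert a b c e
        decide
  have hX' : s (j₀ + L) ∈ X := (hs j₀).symm ▸ hj₀
  have hfin := hg (j₀ + L) hX' (by lia)
  have hcongr : ∀ x, x = s j₀ → ∀ hx : x ∈ X, wt φ (r x hx) = wt φ (r (s j₀) hj₀) := by
    rintro x rfl _
    rfl
  rw [hcongr _ (hs j₀) hX', hf] at hfin
  generalize f j₀ = a at *
  generalize wt φ (r (s j₀) hj₀) = b at *
  clear * - hfin
  revert a b
  decide

/-- A shortest odd closed walk has length at most `2 * cbn G - 2`. -/
theorem exists_odd_closed_walk [Finite V] (hφ : ∀ u v, φ u v = φ v u) (c : G.Walk v v)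
    (hc : wt φ c = 1) :
    ∃ (x : V) (o : G.Walk x x), wt φ o = 1 ∧ o.length + 2 ≤ 2 * cbn G := by
  classical
  have hex : ∃ L, ∃ (x : V) (o : G.Walk x x), wt φ o = 1 ∧ o.length = L := ⟨_, v, c, hc, rfl⟩
  obtain ⟨x, o, ho, hoL⟩ := Nat.find_spec hex
  have hmin : ∀ (x : V) (c : G.Walk x x), c.length < Nat.find hex → wt φ c = 0 := by
    intro x c hc
    have h1 := Nat.find_min hex hc
    push Not at h1
    have h2 := fun h => h1 x c h rfl
    generalize wt φ c = a at *
    clear * - h2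
    revert a
    decide
  set L := Nat.find hex
  refine ⟨x, o, ho, ?_⟩
  have hL2 : 2 ≤ L := by
    by_contra hlt
    cases o with
    | nil => simp at ho
    | cons h p =>
      cases p with
      | nil => exact h.ne rfl
      | cons h' p =>
        simp only [Walk.length_cons] at hoL
        lia
  let s : ℕ → V := fun i => o.getVert (i % L)
  have hs : ∀ i, s (i + L) = s i := fun i => by simp [s]
  have hsL : ∀ i ≤ L, s i = o.getVert i := by
    intro i hi
    rcases hi.eq_or_lt with rfl | hi
    · simp only [s, Nat.mod_self, Walk.getVert_zero]
      rw [← hoL, Walk.getVert_length]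
    · simp only [s, Nat.mod_eq_of_lt hi]
  have hsmod : ∀ i, s (i % L) = s i ∧ s (i % L + 1) = s (i + 1) := fun i => by simp [s]
  have hadj : ∀ i, G.Adj (s i) (s (i + 1)) := by
    intro i
    have hi : i % L < L := Nat.mod_lt _ (by lia)
    rw [← (hsmod i).1, ← (hsmod i).2, hsL _ hi.le, hsL _ hi]
    exact o.adj_getVert_succ (hoL ▸ hi)
  let f : ℕ → ZMod 2 := fun n => ∑ i ∈ Finset.range n, φ (s i) (s (i + 1))
  have hfL : f L = 1 := by
    rw [← ho, wt_eq_sum, hoL]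
    refine Finset.sum_congr rfl fun i hi => ?_
    have := Finset.mem_range.1 hi
    rw [hsL i (by lia), hsL (i + 1) (by lia)]
  have hfs : ∀ n, f (n + 1) = f n + φ (s n) (s (n + 1)) := fun n => Finset.sum_range_succ _ n
  have hf : ∀ i, f (i + L) = f i + 1 := by
    intro i
    induction i with
    | zero => simp [hfL, f]
    | succ i ih =>
      rw [Nat.add_right_comm, hfs, ih, hfs, hs, Nat.add_right_comm, hs]
      ring
  have hseg : ∀ i n, ∃ p : G.Walk (s i) (s (i + n)), p.length = n ∧ wt φ p = f i + f (i + n) := by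
    intro i n
    induction n with
    | zero => exact ⟨.nil, rfl, by simp [CharTwo.add_self_eq_zero]⟩
    | succ n ih =>
      obtain ⟨p, hp, hw⟩ := ih
      refine ⟨p.append (.cons (hadj (i + n)) .nil), by simp [hp], ?_⟩
      have := hfs (i + n)
      rw [wt_append, hw, wt_cons, wt_nil, add_zero, add_assoc, ← this]
      rfl
  set m := L / 2
  have hm : 1 ≤ m := by lia
  let arc : ℕ → Set V := fun i => {y | ∃ j < m, s (i + j) = y}
  have harc0 : ∀ i, s i ∈ arc i := fun i => ⟨0, hm, rfl⟩
  have harclink : ∀ i, ∀ j < m, LinkedIn G (arc i) (s i) (s (i + j)) := by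
    intro i j hj
    induction j with
    | zero => rfl
    | succ j ih =>
      exact (ih (by lia)).trans (.of_adj (hadj (i + j)) ⟨j, by lia, rfl⟩ ⟨j + 1, hj, rfl⟩)
  have hmeet : ∀ i j, ∃ d ≤ m, s (i + d) = s j ∨ s (j + d) = s i := by
    intro i j
    have hmod : ∀ a b, a % L = b % L → s a = s b := fun a b h => by
      rw [← (hsmod a).1, h, (hsmod b).1]
    wlog hij : i % L ≤ j % L generalizing i j
    · obtain ⟨d, hd, h⟩ := this j i (by lia)
      exact ⟨d, hd, h.symm⟩
    have hj := Nat.mod_lt j (show L > 0 by lia)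
    by_cases hd : j % L - i % L ≤ m
    · refine ⟨_, hd, .inl (hmod _ _ ?_)⟩
      rw [Nat.add_mod, Nat.mod_eq_of_lt (show j % L - i % L < L by lia),
        Nat.add_sub_cancel' hij, Nat.mod_mod]
    · refine ⟨L - (j % L - i % L), by lia, .inr (hmod _ _ ?_)⟩
      rw [Nat.add_mod, Nat.mod_eq_of_lt (show L - (j % L - i % L) < L by lia),
        show j % L + (L - (j % L - i % L)) = i % L + L by lia, Nat.add_mod_right, Nat.mod_mod]
  have hunion : ∀ i j, ∀ d ≤ m, s (i + d) = s j → IsConnSet G (arc i ∪ arc j) := by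
    intro i j d hd hij
    refine isConnSet_of_linkedIn (.inl (harc0 i)) ?_
    rintro y (⟨e, he, rfl⟩ | ⟨e, he, rfl⟩)
    · exact (harclink i e he).mono_set Set.subset_union_left
    · refine LinkedIn.trans (v := s j) ?_ ((harclink j e he).mono_set Set.subset_union_right)
      cases d with
      | zero => rw [← hij, add_zero]
      | succ d =>
        refine ((harclink i d hd).mono_set Set.subset_union_left).trans ?_
        rw [← hij]
        exact .of_adj (hadj (i + d)) (.inl ⟨d, hd, rfl⟩) (.inr (by
          exact hij ▸ harc0 j))
  have hbr : IsBramble G (Set.range arc) := by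
    constructor
    · rintro _ ⟨i, rfl⟩
      refine isConnSet_of_linkedIn (harc0 i) ?_
      rintro _ ⟨j, hj, rfl⟩
      exact harclink i j hj
    · rintro _ ⟨i, rfl⟩ _ ⟨j, rfl⟩
      obtain ⟨d, hd, h | h⟩ := hmeet i j
      · exact hunion i j d hd h
      · exact Set.union_comm _ _ ▸ hunion j i d hd h
  have hle := le_cbn hbr ⟨_, 0, rfl⟩ (n := (L + 1) / 2 + 1) fun X hX =>
    half_length_lt_ncard hφ hL2 hmin hs hf hseg hX.1 fun i => by
      obtain ⟨_, hyX, j, hj, rfl⟩ := hX.2 _ ⟨i, rfl⟩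
      exact ⟨j, hj, hyX⟩
  lia

lemma wt_indicator [DecidableEq V] (e : Sym2 V) (p : G.Walk u v) :
    wt (fun a b => if s(a, b) = e then 1 else 0) p = (p.edges.count e : ZMod 2) := by
  induction p with
  | nil => simp
  | cons h p ih =>
    rw [wt_cons, ih, Walk.edges_cons, List.count_cons]
    simp only [beq_iff_eq]
    split_ifs <;> simp [add_comm]

lemma three_le_cbn [Finite V] (h : ¬ G.IsAcyclic) : 3 ≤ cbn G := by
  classical
  unfold IsAcyclic at h
  push Not at h
  obtain ⟨v, c, hc⟩ := h
  obtain ⟨e, he⟩ := List.exists_mem_of_ne_nil c.edges fun h0 => by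
    have := hc.three_le_length
    rw [← Walk.length_edges, h0] at this
    simp at this
  have hsymm : ∀ a b, (if s(a, b) = e then (1 : ZMod 2) else 0) = if s(b, a) = e then 1 else 0 :=
    fun a b => by rw [Sym2.eq_swap]
  obtain ⟨x, o, ho, hol⟩ := exists_odd_closed_walk hsymm c (by
    rw [wt_indicator, List.count_eq_one_of_mem hc.edges_nodup he]
    simp)
  have : 3 ≤ o.length := by
    by_contra hlt
    cases o with
    | nil => simp at ho
    | cons h p =>
      cases p with
      | nil => exact h.ne rfl
      | cons h' p =>
        cases p with
        | nil =>
          rw [wt_cons, wt_cons, wt_nil, add_zero, hsymm, CharTwo.add_self_eq_zero] at ho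
          exact absurd ho (by decide)
        | cons h'' p => simp at hlt
  lia

end

section

variable {V : Type u} {G H : SimpleGraph V} {X Y E W M C : Set V} {u v w : V}

open Classical in
/-- The label of the edges between `X` and `E`. -/
noncomputable def cutLabel (X E : Set V) (u v : V) : ZMod 2 :=
  if u ∈ X ∧ v ∈ E ∨ u ∈ E ∧ v ∈ X then 1 else 0

lemma cutLabel_comm (u v : V) : cutLabel X E u v = cutLabel X E v u := by
  unfold cutLabel
  congr 1
  exact propext ⟨fun h => h.symm.imp And.symm And.symm, fun h => h.symm.imp And.symm And.symm⟩

lemma wt_cutLabel_eq_zero_left (p : G.Walk u v) (hp : ∀ x ∈ p.support, x ∉ X) :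
    wt (cutLabel X E) p = 0 := by
  induction p with
  | nil => rfl
  | @cons a b c h p ih =>
    have hb : b ∉ X := hp b (by simp)
    have ha : a ∉ X := hp a (by simp)
    rw [wt_cons, ih fun x hx => hp x (by simp [hx])]
    simp [cutLabel, ha, hb]

lemma wt_cutLabel_eq_zero_right (p : G.Walk u v) (hp : ∀ x ∈ p.support, x ∉ E) :
    wt (cutLabel X E) p = 0 := by
  induction p with
  | nil => rfl
  | @cons a b c h p ih =>
    have hb : b ∉ E := hp b (by simp)
    have ha : a ∉ E := hp a (by simp)
    rw [wt_cons, ih fun x hx => hp x (by simp [hx])]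
    simp [cutLabel, ha, hb]

/-- `Excursion X Y E u v n`: some walk from `u` to `v` of length `n` passes from `X` to `Y` or back
through `E`. -/
def Excursion (G : SimpleGraph V) (X Y E : Set V) (u v : V) (n : ℕ) : Prop :=
  ∃ (x y : V) (q : G.Walk x y) (p₁ : G.Walk u x) (p₂ : G.Walk y v),
    (∀ z ∈ q.support, z = x ∨ z = y ∨ z ∈ E) ∧ (x ∈ X ∧ y ∈ Y ∨ x ∈ Y ∧ y ∈ X) ∧
    p₁.length + q.length + p₂.length = n

lemma Excursion.prepend {n : ℕ} (h : Excursion G X Y E v w n) (p : G.Walk u v) :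
    Excursion G X Y E u w (p.length + n) := by
  obtain ⟨x, y, q, p₁, p₂, hq, hxy, hl⟩ := h
  exact ⟨x, y, q, p.append p₁, p₂, hq, hxy, by rw [Walk.length_append]; lia⟩

lemma excursion_of_wt (hE : Disjoint E (X ∪ Y))
    (hnb : ∀ e ∈ E, ∀ b, G.Adj e b → b ∈ E ∨ b ∈ X ∪ Y) (p : G.Walk u v) (hv : v ∉ E) :
    (u ∉ E → wt (cutLabel X E) p = 1 → Excursion G X Y E u v p.length) ∧
    (u ∈ E → ∀ (x₀ : V) (q₀ : G.Walk x₀ u), x₀ ∈ X ∪ Y → (∀ z ∈ q₀.support, z = x₀ ∨ z ∈ E) →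
      (x₀ ∈ X ↔ wt (cutLabel X E) p ≠ 1) → Excursion G X Y E x₀ v (q₀.length + p.length)) := by
  have hEX : ∀ e ∈ E, e ∉ X := fun e he hX => Set.disjoint_left.1 hE he (.inl hX)
  have h2 : ∀ a : ZMod 2, 1 + a = 1 ↔ a ≠ 1 := by decide
  induction p with
  | nil => exact ⟨fun _ h => absurd h (by simp), fun h => absurd h hv⟩
  | @cons a b c h p ih =>
    obtain ⟨ihA, ihB⟩ := ih hv
    refine ⟨fun ha hw => ?_, fun ha x₀ q₀ hx₀ hq₀ hw => ?_⟩
    · by_cases hb : b ∈ E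
      · have haW : a ∈ X ∪ Y := (hnb b hb a h.symm).resolve_left ha
        have := ihB hb a (.cons h .nil) haW (by
          intro z hz
          simp only [Walk.support_cons, Walk.support_nil, List.mem_cons, List.not_mem_nil,
            or_false] at hz
          rcases hz with rfl | rfl
          · exact .inl rfl
          · exact .inr hb) (by
          rw [wt_cons] at hw
          by_cases haX : a ∈ X
          · simpa [cutLabel, haX, hb, h2] using hw
          · simpa [cutLabel, haX, ha] using hw)
        convert this using 1
        simp [add_comm]
      · have : cutLabel X E a b = 0 := by simp [cutLabel, ha, hb]
        rw [wt_cons, this, zero_add] at hw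
        convert (ihA hb hw).prepend (.cons h .nil) using 1
        simp [add_comm]
    · have hsup : ∀ z ∈ (q₀.append (.cons h .nil)).support, z = x₀ ∨ z = b ∨ z ∈ E := by
        intro z hz
        rw [Walk.mem_support_append_iff] at hz
        rcases hz with hz | hz
        · exact (hq₀ z hz).imp_right .inr
        · simp only [Walk.support_cons, Walk.support_nil, List.mem_cons, List.not_mem_nil,
            or_false] at hz
          rcases hz with rfl | rfl
          · exact .inr (.inr ha)
          · exact .inr (.inl rfl)
      have haX := hEX a ha
      by_cases hb : b ∈ E
      · have : cutLabel X E a b = 0 := by simp [cutLabel, haX, hEX b hb]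
        rw [wt_cons, this, zero_add] at hw
        convert ihB hb x₀ (q₀.append (.cons h .nil)) hx₀
          (fun z hz => (hsup z hz).imp_right fun h => h.elim (fun h => h ▸ hb) id) hw using 1
        simp only [Walk.length_append, Walk.length_cons, Walk.length_nil]
        lia
      · have hbW : b ∈ X ∪ Y := (hnb a ha b h).resolve_left hb
        have hlen : q₀.length + (Walk.cons h p).length =
            (q₀.append (.cons h .nil)).length + p.length := by
          simp only [Walk.length_append, Walk.length_cons, Walk.length_nil]
          lia
        rw [hlen]
        by_cases hside : x₀ ∈ X ↔ b ∈ X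
        · refine (ihA hb ?_).prepend _
          rw [wt_cons, hside] at hw
          by_cases hbX : b ∈ X
          · simpa [cutLabel, ha, hbX, h2] using hw
          · simpa [cutLabel, haX, hb, hbX] using hw
        · refine ⟨x₀, b, q₀.append (.cons h .nil), .nil, p, hsup, ?_, by simp⟩
          simp only [Set.mem_union] at hx₀ hbW
          tauto

/-- A closed walk crossing the cut between `X` and `E` an odd number of times contains a short
detour from `X` to `Y` through `E`. -/
lemma exists_detour (hXY : Disjoint X Y) (hE : Disjoint E (X ∪ Y))
    (hnb : ∀ e ∈ E, ∀ b, G.Adj e b → b ∈ E ∨ b ∈ X ∪ Y) (hadj : ∀ x ∈ X, ∀ y ∈ Y, ¬ G.Adj x y)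
    (o : G.Walk u u) (ho : wt (cutLabel X E) o = 1) :
    ∃ x ∈ X, ∃ y ∈ Y, ∃ q : G.Walk x y, (∀ z ∈ q.support, z = x ∨ z = y ∨ z ∈ E) ∧
      q.length + 2 ≤ o.length := by
  classical
  obtain ⟨z, hz, hzE⟩ : ∃ z ∈ o.support, z ∉ E := by
    by_contra! hcon
    rw [wt_cutLabel_eq_zero_left o fun x hx hX =>
      Set.disjoint_left.1 hE (hcon x hx) (.inl hX)] at ho
    exact absurd ho (by decide)
  have hspec := o.take_spec hz
  have hw : wt (cutLabel X E) ((o.dropUntil z hz).append (o.takeUntil z hz)) = 1 := by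
    rw [wt_append, add_comm, ← wt_append, hspec, ho]
  have hl : ((o.dropUntil z hz).append (o.takeUntil z hz)).length = o.length := by
    rw [Walk.length_append, add_comm, ← Walk.length_append, hspec]
  obtain ⟨x, y, q, p₁, p₂, hq, hxy, hlen⟩ := (excursion_of_wt hE hnb _ hzE).1 hzE hw
  rw [hl] at hlen
  have hne : x ≠ y := by
    rintro rfl
    rcases hxy with h | h
    · exact Set.disjoint_left.1 hXY h.1 h.2
    · exact Set.disjoint_left.1 hXY h.2 h.1
  have hnadj : ¬ G.Adj y x := fun h => hxy.elim (fun h' => hadj x h'.1 y h'.2 h.symm)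
    fun h' => hadj y h'.2 x h'.1 h
  have h2 : 2 ≤ (p₂.append p₁).length := by
    by_contra hlt
    have h01 : (p₂.append p₁).length = 0 ∨ (p₂.append p₁).length = 1 := by lia
    rcases h01 with h | h
    · exact hne (Walk.eq_of_length_eq_zero h).symm
    · exact hnadj (Walk.adj_of_length_eq_one h)
  rw [Walk.length_append] at h2
  rcases hxy with ⟨hx, hy⟩ | ⟨hy, hx⟩
  · exact ⟨x, hx, y, hy, q, hq, by lia⟩
  · refine ⟨y, hx, x, hy, q.reverse, fun z hz => ?_, by rw [Walk.length_reverse]; lia⟩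
    rw [Walk.support_reverse, List.mem_reverse] at hz
    rcases hq z hz with h | h | h
    · exact .inr (.inl h)
    · exact .inl h
    · exact .inr (.inr h)

/-- If `M ⊆ W` meets every component of `W` and `W` is disconnected, two components of `W` can be
joined by a short path through `C`. -/
lemma exists_ear [Finite V] {k : ℕ} (hH : IsMinChordal G k H) (hM : H.IsClique M)
    (hMmax : ∀ w, (∀ m ∈ M, H.Adj m w) → w ∈ M) (hC : IsConnSet G C) (hbC : bdry G C ⊆ M)
    (hMW : M ⊆ W) (hWC : W ⊆ C ∪ bdry G C) (hrep : ∀ w ∈ W, ∃ m ∈ M, LinkedIn G W w m)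
    (hW : ∃ x ∈ W, ∃ y ∈ W, ¬ LinkedIn G W x y) :
    ∃ (n : ℕ) (s : ℕ → V), n + 4 ≤ 2 * cbn G ∧ (∀ i < n, G.Adj (s i) (s (i + 1))) ∧
      (∀ i ≤ n, ∀ j ≤ n, s i = s j → i = j) ∧ s 0 ∈ W ∧ s n ∈ W ∧ ¬ LinkedIn G W (s 0) (s n) ∧
      ∀ i, 0 < i → i < n → s i ∈ C \ W := by
  classical
  have hCC : ∀ x ∈ C ∪ bdry G C, ∃ c ∈ C, LinkedIn G (C ∪ bdry G C) x c := by
    rintro x (hx | ⟨hx, c, hc, hcx⟩)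
    · exact ⟨x, hx, .refl x⟩
    · exact ⟨c, hc, .of_adj hcx.symm (.inr ⟨hx, c, hc, hcx⟩) (.inl hc)⟩
  have hex : ∃ n, ∃ x ∈ W, ∃ y ∈ W, ¬ LinkedIn G W x y ∧
      ∃ p : G.Walk x y, (∀ z ∈ p.support, z ∈ C ∪ bdry G C) ∧ p.length = n := by
    obtain ⟨x, hx, y, hy, hxy⟩ := hW
    obtain ⟨c, hc, hxc⟩ := hCC x (hWC hx)
    obtain ⟨d, hd, hyd⟩ := hCC y (hWC hy)
    have : LinkedIn G (C ∪ bdry G C) x y :=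
      (hxc.trans ((hC.linkedIn hc hd).mono_set Set.subset_union_left)).trans hyd.symm
    obtain ⟨p, hp⟩ := this.exists_walk (hWC hx)
    exact ⟨_, x, hx, y, hy, hxy, p, hp, rfl⟩
  obtain ⟨x, hx, y, hy, hxy, p', hp', hpn'⟩ := Nat.find_spec hex
  have hmin : ∀ x ∈ W, ∀ y ∈ W, ¬ LinkedIn G W x y → ∀ p : G.Walk x y,
      (∀ z ∈ p.support, z ∈ C ∪ bdry G C) → Nat.find hex ≤ p.length :=
    fun x hx y hy hxy p hp => Nat.find_min' hex ⟨x, hx, y, hy, hxy, p, hp, rfl⟩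
  set n := Nat.find hex
  obtain ⟨p, hpp, hp, hpn⟩ : ∃ p : G.Walk x y, p.IsPath ∧ (∀ z ∈ p.support, z ∈ C ∪ bdry G C) ∧
      p.length = n := by
    have hsub : ∀ z ∈ p'.bypass.support, z ∈ C ∪ bdry G C :=
      fun z hz => hp' z (p'.support_bypass_subset_support hz)
    exact ⟨p'.bypass, p'.bypass_isPath, hsub,
      (p'.length_bypass_le_length.trans hpn'.le).antisymm (hmin x hx y hy hxy _ hsub)⟩
  clear p' hp' hpn'
  have hint : ∀ i, 0 < i → i < n → p.getVert i ∉ W := by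
    intro i hi hin hiW
    by_cases h1 : LinkedIn G W x (p.getVert i)
    · have := hmin _ hiW y hy (fun h => hxy (h1.trans h)) (p.drop i)
        fun z hz => hp z ((p.isSubwalk_drop i).support_subset hz)
      rw [Walk.drop_length] at this
      lia
    · have := hmin x hx _ hiW h1 (p.take i)
        fun z hz => hp z ((p.isSubwalk_take i).support_subset hz)
      rw [Walk.take_length] at this
      lia
  have hintC : ∀ i, 0 < i → i < n → p.getVert i ∈ C \ M := fun i hi hin =>
    have h1 := hint i hi hin
    ⟨(hp _ (p.getVert_mem_support i)).resolve_right fun h => h1 (hMW (hbC h)),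
      fun h => h1 (hMW h)⟩
  have hn0 : 2 ≤ n := by
    by_contra hlt
    have h01 : p.length = 0 ∨ p.length = 1 := by lia
    rcases h01 with h | h
    · obtain rfl := Walk.eq_of_length_eq_zero h
      exact hxy (.refl x)
    · exact hxy (.of_adj (Walk.adj_of_length_eq_one h) hx hy)
  set D := comp G (C \ M) (p.getVert 1) with hD
  have hDC : D ⊆ C \ M := comp_subset (hintC 1 (by lia) (by lia))
  have hintD : ∀ i, 0 < i → i < n → p.getVert i ∈ D := by
    intro i hi hin
    induction i with
    | zero => lia
    | succ i ih =>
      rcases Nat.eq_zero_or_pos i with rfl | hi0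
      · exact mem_comp_self _
      · exact comp_closed (hintC 1 (by lia) (by lia)) (ih hi0 (by lia))
          (p.adj_getVert_succ (by lia)) (hintC _ hi hin)
  have hnbD : ∀ e ∈ D, ∀ b, G.Adj e b → b ∈ D ∨ b ∈ M := by
    intro e he b heb
    by_cases hbM : b ∈ M
    · exact .inr hbM
    · rcases mem_or_mem_bdry (hDC he).1 heb with hb | hb
      · exact .inl (comp_closed (hintC 1 (by lia) (by lia)) he heb ⟨hb, hbM⟩)
      · exact .inr (hbC hb)
  set X := {w ∈ W | LinkedIn G W x w} with hX
  have hXW : X ∪ W \ X = W := Set.union_sdiff_cancel fun w hw => hw.1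
  have hyX : y ∉ X := fun h => hxy h.2
  have hXE : wt (cutLabel X (D \ W)) p = 1 := by
    cases p with
    | nil => simp at hpn; lia
    | @cons _ b _ h p =>
      have hb : b ∈ D \ W := by
        have h1 := hintD 1 (by lia) (by lia)
        have h2 := hint 1 (by lia) (by lia)
        simp only [Walk.getVert_cons_succ, Walk.getVert_zero] at h1 h2
        exact ⟨h1, h2⟩
      rw [wt_cons, wt_cutLabel_eq_zero_left p, add_zero]
      · have hxX : x ∈ X := ⟨hx, .refl x⟩
        simp only [cutLabel, hxX, hb, true_and, true_or, if_true]
      · intro z hz hzX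
        obtain ⟨i, rfl, hi⟩ := Walk.mem_support_iff_exists_getVert.1 hz
        rcases hi.eq_or_lt with rfl | hi
        · rw [Walk.getVert_length] at hzX
          exact hyX hzX
        · have := hint (i + 1) (by lia) (by rw [Walk.length_cons] at hpn; lia)
          rw [Walk.getVert_cons_succ] at this
          exact this hzX.1
  have hback : LinkedIn G (D \ W)ᶜ y x := by
    obtain ⟨m₁, hm₁, h₁⟩ := hrep x hx
    obtain ⟨m₂, hm₂, h₂⟩ := hrep y hy
    have hWsub : W ⊆ (D \ W)ᶜ := fun w hw h => h.2 hw
    refine ((h₂.mono_set hWsub).trans ?_).trans (h₁.mono_set hWsub).symm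
    refine (hH.linkedIn_compl hM hMmax (D := D) (isConnSet_comp _)
      (Set.disjoint_left.2 fun z hz => (hDC hz).2) ?_ hm₂ hm₁).mono_set
      (Set.compl_subset_compl.2 Set.sdiff_subset)
    rintro b ⟨hb, e, he, heb⟩
    exact (hnbD e he b heb).resolve_left hb
  obtain ⟨r, hr⟩ := hback.exists_walk fun h => h.2 hy
  obtain ⟨z, o, ho, hol⟩ := exists_odd_closed_walk (cutLabel_comm (X := X) (E := D \ W))
    (p.append r) (by rw [wt_append, hXE, wt_cutLabel_eq_zero_right r fun x hx => hr x hx, add_zero])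
  obtain ⟨x', hx', y', hy', q, hq, hql⟩ := exists_detour (X := X) (Y := W \ X) (E := D \ W)
    Set.disjoint_sdiff_right (by rw [hXW]; exact Set.disjoint_sdiff_left)
    (by
      intro e he b heb
      rw [hXW]
      by_cases hbW : b ∈ W
      · exact .inr hbW
      · exact .inl ⟨(hnbD e he.1 b heb).resolve_right fun h => hbW (hMW h), hbW⟩)
    (fun a ha b hb hab => hb.2 ⟨hb.1, ha.2.trans (.of_adj hab ha.1 hb.1)⟩) o ho
  have hle := hmin x' hx'.1 y' hy'.1
    (fun h => hy'.2 ⟨hy'.1, hx'.2.trans h⟩) q (by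
      intro z hz
      rcases hq z hz with rfl | rfl | h
      · exact hWC hx'.1
      · exact hWC hy'.1
      · exact .inl (hDC h.1).1)
  refine ⟨n, p.getVert, by lia, fun i hi => p.adj_getVert_succ (hpn ▸ hi), ?_, ?_, ?_, ?_, ?_⟩
  · exact fun i hi j hj hij => hpp.getVert_injOn (show i ≤ p.length by lia)
      (show j ≤ p.length by lia) hij
  · rwa [Walk.getVert_zero]
  · rwa [← hpn, Walk.getVert_length]
  · rwa [← hpn, Walk.getVert_length, Walk.getVert_zero]
  · exact fun i hi hin => ⟨(hintC i hi hin).1, hint i hi hin⟩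

end

section

variable {V : Type u} {G H : SimpleGraph V} {W D N M C Y : Set V} {a n : ℕ}

/-- A set `R ⊆ N` of representatives meets every component of `W` restricted to `D ∪ N`, and every
`a` vertices of `W` in `D` have saved one representative. -/
def Pot (G : SimpleGraph V) (a : ℕ) (W D N : Set V) : Prop :=
  ∃ R ⊆ N, (∀ v ∈ W ∩ D ∪ N, ∃ r ∈ R, LinkedIn G (W ∩ (D ∪ N)) v r) ∧
    (W ∩ D).ncard + a * R.ncard ≤ a * N.ncard

lemma pot_empty (G : SimpleGraph V) (a : ℕ) (D N : Set V) : Pot G a ∅ D N :=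
  ⟨N, subset_rfl, fun v hv => ⟨v, hv.resolve_left fun h => h.1, .refl v⟩, by simp⟩

lemma exists_anchor {S : Set V} {s : ℕ → V} (hDN : bdry G D ⊆ N)
    (hadj : ∀ i < n, G.Adj (s i) (s (i + 1))) (hS : ∀ i ≤ n, s i ∈ S) {i : ℕ} (hi : i ≤ n)
    (hiD : s i ∈ D) : ∃ j ≤ n, (s j ∈ N ∧ j < i ∨ j = 0 ∧ s 0 ∈ D) ∧
      LinkedIn G (S ∩ (D ∪ N)) (s i) (s j) := by
  induction i with
  | zero => exact ⟨0, hi, .inr ⟨rfl, hiD⟩, .refl _⟩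
  | succ i ih =>
    have hstep := (hadj i hi).symm
    rcases mem_or_mem_bdry hiD hstep with h | h
    · obtain ⟨j, hj, hjN, hl⟩ := ih (by lia) h
      exact ⟨j, hj, hjN.imp_left fun h => ⟨h.1, by lia⟩,
        .trans (.of_adj hstep ⟨hS _ hi, .inl hiD⟩ ⟨hS _ (by lia), .inl h⟩) hl⟩
    · exact ⟨i, by lia, .inl ⟨hDN h, by lia⟩,
        .of_adj hstep ⟨hS _ hi, .inl hiD⟩ ⟨hS _ (by lia), .inr (hDN h)⟩⟩

lemma Pot.union_path [Finite V] {s : ℕ → V} (h : Pot G a W D N) (hDN : bdry G D ⊆ N)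
    (hn : n ≤ a + 1) (hadj : ∀ i < n, G.Adj (s i) (s (i + 1)))
    (hinj : ∀ i ≤ n, ∀ j ≤ n, s i = s j → i = j) (h0 : s 0 ∈ W) (hnW : s n ∈ W)
    (hlink : ¬ LinkedIn G W (s 0) (s n)) (hint : ∀ i, 0 < i → i < n → s i ∉ W) :
    Pot G a (W ∪ s '' Set.Ioo 0 n) D N := by
  obtain ⟨R, hRN, hrep, hcard⟩ := h
  set W' := W ∪ s '' Set.Ioo 0 n with hW'
  have hWW' : W ∩ (D ∪ N) ⊆ W' ∩ (D ∪ N) :=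
    Set.inter_subset_inter_left _ Set.subset_union_left
  have hS : ∀ i ≤ n, s i ∈ W' := by
    intro i hi
    rcases Nat.eq_zero_or_pos i with rfl | hi0
    · exact .inl h0
    rcases hi.eq_or_lt with rfl | hin
    · exact .inl hnW
    · exact .inr ⟨i, ⟨hi0, hin⟩, rfl⟩
  by_cases hex : ∃ i, 0 < i ∧ i < n ∧ s i ∈ D
  swap
  · have hWD : W' ∩ D = W ∩ D := by
      ext v
      refine ⟨?_, fun hv => ⟨.inl hv.1, hv.2⟩⟩
      rintro ⟨hv | ⟨i, hi, rfl⟩, hvD⟩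
      · exact ⟨hv, hvD⟩
      · exact absurd ⟨i, hi.1, hi.2, hvD⟩ hex
    refine ⟨R, hRN, fun v hv => ?_, hWD ▸ hcard⟩
    rw [hWD] at hv
    obtain ⟨r, hr, hvr⟩ := hrep v hv
    exact ⟨r, hr, hvr.mono_set hWW'⟩
  obtain ⟨i, hi0, hin, hiD⟩ := hex
  obtain ⟨j, hjn, hj, hlj⟩ := exists_anchor hDN hadj hS hin.le hiD
  obtain ⟨k', hkn', hk', hlk⟩ := exists_anchor (s := fun i => s (n - i)) (n := n) (i := n - i) hDN
    (fun i hi => by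
      have := (hadj (n - (i + 1)) (by lia)).symm
      rwa [show n - (i + 1) + 1 = n - i by lia] at this)
    (fun i _ => hS _ (by lia)) (by lia) (by simpa [Nat.sub_sub_self hin.le] using hiD)
  simp only [Nat.sub_sub_self hin.le] at hlk
  obtain ⟨k, hk, hlk, hkn, hik⟩ : ∃ k, (s k ∈ N ∨ k = n ∧ s n ∈ D) ∧
      LinkedIn G (W' ∩ (D ∪ N)) (s i) (s k) ∧ k ≤ n ∧ i < k :=
    ⟨n - k', hk'.imp And.left fun h => ⟨by lia, by simpa using h.2⟩, hlk, by lia, by lia⟩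
  have hji : j < i := by lia
  have hjm : s j ∈ W ∩ D ∪ N := by
    rcases hj with h | ⟨rfl, h⟩
    · exact .inr h.1
    · exact .inl ⟨h0, h⟩
  have hkm : s k ∈ W ∩ D ∪ N := by
    rcases hk with h | ⟨rfl, h⟩
    · exact .inr h
    · exact .inl ⟨hnW, h⟩
  obtain ⟨α, hα, hjα⟩ := hrep _ hjm
  obtain ⟨β, hβ, hkβ⟩ := hrep _ hkm
  have hne : α ≠ β := by
    rintro rfl
    have hl : LinkedIn G W (s j) (s k) := (hjα.trans hkβ.symm).mono_set Set.inter_subset_left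
    obtain ⟨hjW, hkW⟩ := hl.mem_of_ne fun h => absurd (hinj j hjn k hkn h) (by lia)
    obtain rfl : j = 0 := by
      by_contra hj0
      exact hint j (by lia) (by lia) hjW
    obtain rfl : k = n := by
      by_contra hk0
      exact hint k (by lia) (by lia) hkW
    exact hlink hl
  have hβα : LinkedIn G (W' ∩ (D ∪ N)) β α :=
    (((hkβ.mono_set hWW').symm.trans hlk.symm).trans hlj).trans (hjα.mono_set hWW')
  have hold : ∀ v ∈ W ∩ D ∪ N, ∃ r ∈ R \ {β}, LinkedIn G (W' ∩ (D ∪ N)) v r := by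
    intro v hv
    obtain ⟨r, hr, hvr⟩ := hrep v hv
    by_cases hrβ : r = β
    · subst hrβ
      exact ⟨α, ⟨hα, hne⟩, (hvr.mono_set hWW').trans hβα⟩
    · exact ⟨r, ⟨hr, hrβ⟩, hvr.mono_set hWW'⟩
  refine ⟨R \ {β}, Set.sdiff_subset.trans hRN, ?_, ?_⟩
  · rintro v (⟨hv | ⟨l, hl, rfl⟩, hvD⟩ | hv)
    · exact hold v (.inl ⟨hv, hvD⟩)
    · obtain ⟨m, -, hm, hlm⟩ := exists_anchor hDN hadj hS hl.2.le hvD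
      obtain ⟨r, hr, hmr⟩ := hold (s m) (by
        rcases hm with h | ⟨rfl, h⟩
        · exact .inr h.1
        · exact .inl ⟨h0, h⟩)
      exact ⟨r, hr, hlm.trans hmr⟩
    · exact hold v (.inr hv)
  · have h1 : (W' ∩ D).ncard ≤ (W ∩ D).ncard + a := by
      calc (W' ∩ D).ncard ≤ (W ∩ D ∪ s '' Set.Ioo 0 n).ncard :=
            Set.ncard_le_ncard (fun v hv => hv.1.imp (fun h => ⟨h, hv.2⟩) id) (Set.toFinite _)
        _ ≤ (W ∩ D).ncard + (s '' Set.Ioo 0 n).ncard := Set.ncard_union_le _ _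
        _ ≤ (W ∩ D).ncard + a := by
            gcongr
            refine (Set.ncard_image_le (Set.toFinite _)).trans ?_
            rw [Set.ncard_eq_toFinset_card']
            simp only [Set.toFinset_Ioo, Nat.card_Ioo]
            lia
    have h2 : (R \ {β}).ncard + 1 = R.ncard := Set.ncard_sdiff_singleton_add_one hβ (Set.toFinite _)
    rw [← h2, mul_add, mul_one] at hcard
    lia

lemma bdry_sdiff_subset (hbC : bdry G C ⊆ M) : bdry G (C \ M) ⊆ M := by
  rintro v ⟨hv, c, hc, hcv⟩
  by_contra hvM
  rcases mem_or_mem_bdry hc.1 hcv with h | h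
  · exact hv ⟨h, hvM⟩
  · exact hvM (hbC h)

lemma exists_saturated [Finite V] {k : ℕ} {W₀ : Set V} (ha : 2 * cbn G ≤ a + 5)
    (hH : IsMinChordal G k H) (hM : H.IsClique M)
    (hMmax : ∀ w, (∀ m ∈ M, H.Adj m w) → w ∈ M) (hC : IsConnSet G C) (hbC : bdry G C ⊆ M)
    (hMW : M ⊆ W₀) (hWC : W₀ ⊆ C ∪ bdry G C) (hP : Pot G a W₀ (C \ M) M)
    (hPD : ∀ D ⊆ C \ M, Pot G a W₀ D (bdry G D)) :
    ∃ W, W₀ ⊆ W ∧ W ⊆ C ∪ bdry G C ∧ (∀ x ∈ W, ∀ y ∈ W, LinkedIn G W x y) ∧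
      Pot G a W (C \ M) M ∧ ∀ D ⊆ C \ M, Pot G a W D (bdry G D) := by
  obtain ⟨W, hW₀, hW⟩ := (Set.toFinite {W | W ⊆ C ∪ bdry G C ∧ Pot G a W (C \ M) M ∧
    ∀ D ⊆ C \ M, Pot G a W D (bdry G D)}).exists_le_maximal ⟨hWC, hP, hPD⟩
  obtain ⟨hW₁, hW₂, hW₃⟩ := hW.prop
  refine ⟨W, hW₀, hW₁, ?_, hW₂, hW₃⟩
  by_contra! hcon
  obtain ⟨n, s, hn, hadj, hinj, h0, hnW, hlink, hint⟩ :=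
    exists_ear hH hM hMmax hC hbC (hMW.trans hW₀) hW₁ (fun w hw => by
      obtain ⟨R, hR, hrep, -⟩ := hW₂
      obtain ⟨r, hr, hwr⟩ := hrep w (by
        by_cases hwM : w ∈ M
        · exact .inr hwM
        · exact .inl ⟨hw, (hW₁ hw).resolve_right fun h => hwM (hbC h), hwM⟩)
      exact ⟨r, hR hr, hwr.mono_set Set.inter_subset_left⟩) hcon
  have hint' := fun i hi hin => (hint i hi hin).2
  have hle : W ∪ s '' Set.Ioo 0 n ⊆ W := hW.le_of_ge ⟨Set.union_subset hW₁ (by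
      rintro _ ⟨i, hi, rfl⟩
      exact .inl (hint i hi.1 hi.2).1),
    hW₂.union_path (bdry_sdiff_subset hbC) (by lia) hadj hinj h0 hnW hlink hint',
    fun D hD => (hW₃ D hD).union_path subset_rfl (by lia) hadj hinj h0 hnW hlink hint'⟩
    Set.subset_union_left
  have h1n : 1 < n := by
    by_contra hlt
    obtain rfl | rfl : n = 0 ∨ n = 1 := by lia
    · exact hlink (.refl _)
    · exact hlink (.of_adj (hadj 0 one_pos) h0 hnW)
  exact hint' 1 one_pos h1n (hle (.inr ⟨1, ⟨one_pos, h1n⟩, rfl⟩))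

lemma RD.attach_comps [Finite V] {Q : Set V → Prop} {B₀ A₀ : Set V} (h : RD G Q {∅} B₀ A₀)
    (hY : bdry G Y ⊆ B₀) (hAY : A₀ ∩ Y ⊆ B₀)
    (hcomp : ∀ y ∈ Y, ∃ B, RD G Q {∅} B (comp G Y y ∪ bdry G (comp G Y y)) ∧
      bdry G (comp G Y y) ∪ B₀ ∩ comp G Y y ⊆ B) :
    RD G Q {∅} B₀ (A₀ ∪ Y) := by
  obtain ⟨U, -, hU⟩ := (Set.toFinite {U | U ⊆ Y ∧ (∀ x ∈ U, ∀ y ∈ Y, LinkedIn G Y x y → y ∈ U) ∧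
    RD G Q {∅} B₀ (A₀ ∪ U)}).exists_le_maximal (a := ∅)
    ⟨Set.empty_subset Y, fun x hx => hx.elim, by rwa [Set.union_empty]⟩
  obtain ⟨hUY, hUc, hUR⟩ := hU.prop
  suffices hYU : Y ⊆ U by rwa [hUY.antisymm hYU] at hUR
  intro y hy
  by_contra hyU
  obtain ⟨B, hB, hDB⟩ := hcomp y hy
  set D := comp G Y y with hD
  have hDY : D ⊆ Y := comp_subset hy
  have hDU : ∀ x ∈ D, x ∉ U := fun x hx hxU => hyU (hUc x hxU y hy (LinkedIn.symm hx))
  have hbD : bdry G D ⊆ B₀ := fun x hx =>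
    hY ⟨bdry_comp_subset hy hx, hx.2.imp fun d hd => ⟨hDY hd.1, hd.2⟩⟩
  have hBA := h.subset
  have hR : RD G Q {∅} B₀ (A₀ ∪ U ∪ (D ∪ bdry G D)) := by
    refine hUR.attach hB ?_ ?_ ?_
    · rintro x ⟨hxA, hx | hx⟩
      · have := hAY ⟨hxA.resolve_right (hDU x hx), hDY hx⟩
        exact ⟨this, hDB (.inr ⟨this, hx⟩)⟩
      · exact ⟨hbD hx, hDB (.inl hx)⟩
    · exact fun x hx hxB v hxv => .inr (mem_or_mem_bdry (hx.resolve_right fun h => hxB (hbD h)) hxv)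
    · rintro x hx v (hv | hv) hxv
      · exact .inl (mem_or_mem_bdry hv hxv.symm)
      · exact .inr (.inl (hBA (hbD hv)))
  have hle : U ∪ D ⊆ U := hU.le_of_ge ⟨Set.union_subset hUY hDY, ?_, ?_⟩ Set.subset_union_left
  · exact hyU (hle (.inr (mem_comp_self y)))
  · rintro x (hx | hx) z hz hxz
    · exact .inl (hUc x hx z hz hxz)
    · exact .inr (LinkedIn.trans hx hxz)
  · convert hR using 1
    rw [← Set.union_assoc, ← Set.union_assoc]
    exact (Set.union_eq_left.2 fun x hx => .inl (.inl (hBA (hbD hx)))).symm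

/-- The property of the bags of the tree-decomposition to be constructed. -/
def SmallConn (G : SimpleGraph V) (B : Set V) : Prop :=
  IsConnSet G B ∧ B.ncard ≤ 2 * (cbn G - 1) * (cbn G - 2) + 1

lemma smallConn_of_pot [Finite V] (h3 : 3 ≤ cbn G) (ha : a + 5 = 2 * cbn G) (hne : M.Nonempty)
    (hMk : M.ncard ≤ cbn G) (hMW : M ⊆ W) (hbC : bdry G C ⊆ M) (hWC : W ⊆ C ∪ bdry G C)
    (hlink : ∀ x ∈ W, ∀ y ∈ W, LinkedIn G W x y) (hP : Pot G a W (C \ M) M) : SmallConn G W := by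
  obtain ⟨m, hm⟩ := hne
  refine ⟨isConnSet_of_linkedIn (hMW hm) (hlink m (hMW hm)), ?_⟩
  obtain ⟨R, hR, hrep, hcard⟩ := hP
  obtain ⟨r, hr, -⟩ := hrep m (.inr hm)
  have hR1 : 1 ≤ R.ncard := (Set.ncard_pos (Set.toFinite R)).2 ⟨r, hr⟩
  have hW : W.ncard ≤ M.ncard + (W ∩ (C \ M)).ncard := by
    refine (Set.ncard_le_ncard (fun w hw => ?_) (Set.toFinite _)).trans (Set.ncard_union_le _ _)
    by_cases hwM : w ∈ M
    · exact .inl hwM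
    · exact .inr ⟨hw, (hWC hw).resolve_right fun h => hwM (hbC h), hwM⟩
  obtain ⟨k, hk⟩ := Nat.exists_eq_add_of_le h3
  rw [hk] at hMk ⊢
  obtain rfl : a = 2 * k + 1 := by lia
  rw [show 3 + k - 1 = k + 2 by lia, show 3 + k - 2 = k + 1 by lia]
  nlinarith [Nat.mul_le_mul_left (2 * k + 1) hR1, Nat.mul_le_mul_left (2 * k + 1) hMk]

lemma IsMinChordal.exists_maximal_clique [Finite V] (hH : IsMinChordal G (cbn G) H)
    (hC : IsConnSet G C) (hcl : H.IsClique (bdry G C)) :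
    ∃ M, H.IsClique M ∧ (∀ w, (∀ m ∈ M, H.Adj m w) → w ∈ M) ∧ bdry G C ⊆ M ∧
      M ⊆ C ∪ bdry G C ∧ (M ∩ C).Nonempty ∧ M.ncard ≤ cbn G := by
  obtain ⟨c, hc, hcS⟩ := hH.1.2.exists_common_adj (S := bdry G C) (Set.subset_univ C)
    (isConnSet_iff.2 ⟨hC.1, fun x hx y hy => (hC.linkedIn hx hy).mono hH.1.1 subset_rfl⟩)
    (Set.subset_univ _) hcl disjoint_bdry.symm
    fun s hs => hs.2.imp fun d hd => ⟨hd.1, hH.1.1 hd.2.symm⟩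
  obtain ⟨M, hcM, hM⟩ := (Set.toFinite {M | H.IsClique M}).exists_le_maximal
    (a := insert c (bdry G C)) (hcl.insert fun b hb _ => (hcS b hb).symm)
  refine ⟨M, hM.prop, fun w hw => ?_, fun v hv => hcM (.inr hv), fun m hm => ?_,
    ⟨c, hcM (.inl rfl), hc⟩, hH.1.2.ncard_le hM.prop (Set.subset_univ M)⟩
  · exact hM.le_of_ge (y := insert w M) (hM.prop.insert fun b hb _ => (hw b hb).symm)
      (Set.subset_insert w M) (.inl rfl)
  · by_cases hmc : m = c
    · exact .inl (hmc ▸ hc)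
    · exact (mem_or_mem_bdry hc (hM.prop (hcM (.inl rfl)) hm fun h => hmc h.symm)).imp_right
        fun h => hH.bdry_subset hcl h

lemma Pot.start {W' : Set V} [Finite V] (hP : Pot G a W' C (bdry G C)) (hbC : bdry G C ⊆ M) :
    Pot G a (M ∪ W' ∩ C) (C \ M) M := by
  obtain ⟨R, hR, hrep, hcard⟩ := hP
  have hsub : W' ∩ (C ∪ bdry G C) ⊆ (M ∪ W' ∩ C) ∩ (C \ M ∪ M) := by
    rintro v ⟨hv, hvC | hvC⟩
    · refine ⟨.inr ⟨hv, hvC⟩, ?_⟩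
      by_cases hvM : v ∈ M
      · exact .inr hvM
      · exact .inl ⟨hvC, hvM⟩
    · exact ⟨.inl (hbC hvC), .inr (hbC hvC)⟩
  refine ⟨R ∪ M \ bdry G C, Set.union_subset (hR.trans hbC) Set.sdiff_subset, fun v hv => ?_, ?_⟩
  · by_cases hvn : v ∈ M \ bdry G C
    · exact ⟨v, .inr hvn, .refl v⟩
    · obtain ⟨r, hr, hvr⟩ := hrep v (by
        rcases hv with hv | hv
        · exact .inl (hv.1.resolve_left hv.2.2)
        · exact .inr (by_contra fun h => hvn ⟨hv, h⟩))
      exact ⟨r, .inl hr, hvr.mono_set hsub⟩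
  · have h1 : ((M ∪ W' ∩ C) ∩ (C \ M)).ncard ≤ (W' ∩ C).ncard :=
      Set.ncard_le_ncard (fun v hv => hv.1.resolve_left hv.2.2) (Set.toFinite _)
    have h2 : (R ∪ M \ bdry G C).ncard ≤ R.ncard + (M \ bdry G C).ncard := Set.ncard_union_le _ _
    have h3 : (M \ bdry G C).ncard + (bdry G C).ncard = M.ncard :=
      Set.ncard_sdiff_add_ncard_of_subset hbC (Set.toFinite _)
    rw [← h3]
    nlinarith [Nat.mul_le_mul_left a h2]

lemma Pot.start_of_subset {W' : Set V} (hP : Pot G a W' D (bdry G D)) (hbC : bdry G C ⊆ M)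
    (hD : D ⊆ C \ M) : Pot G a (M ∪ W' ∩ C) D (bdry G D) := by
  obtain ⟨R, hR, hrep, hcard⟩ := hP
  have hWD : (M ∪ W' ∩ C) ∩ D = W' ∩ D := by
    ext v
    exact ⟨fun hv => ⟨(hv.1.resolve_left (hD hv.2).2).1, hv.2⟩,
      fun hv => ⟨.inr ⟨hv.1, (hD hv.2).1⟩, hv.2⟩⟩
  refine ⟨R, hR, fun v hv => ?_, hWD ▸ hcard⟩
  rw [hWD] at hv
  obtain ⟨r, hr, hvr⟩ := hrep v hv
  refine ⟨r, hr, hvr.mono_set ?_⟩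
  rintro x ⟨hx, hxD⟩
  refine ⟨?_, hxD⟩
  rcases hxD with h | ⟨-, d, hd, hdx⟩
  · exact .inr ⟨hx, (hD h).1⟩
  · exact (mem_or_mem_bdry (hD hd).1 hdx).elim (fun h => .inr ⟨hx, h⟩) fun h => .inl (hbC h)

lemma exists_rd_smallConn_of_pot [Finite V] (h3 : 3 ≤ cbn G) (ha : a + 5 = 2 * cbn G)
    (hH : IsMinChordal G (cbn G) H) {C W' : Set V} (hC : IsConnSet G C)
    (hcl : H.IsClique (bdry G C)) (hP : ∀ D ⊆ C, Pot G a W' D (bdry G D)) :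
    ∃ B, RD G (SmallConn G) {∅} B (C ∪ bdry G C) ∧ bdry G C ∪ W' ∩ C ⊆ B := by
  induction hm : C.ncard using Nat.strong_induction_on generalizing C W' with
  | _ m ih =>
    obtain ⟨M, hM, hMmax, hbC, hMC, ⟨c, hcM, hcC⟩, hMk⟩ := hH.exists_maximal_clique hC hcl
    obtain ⟨W, hW₀, hWC, hlink, hPM, hPD⟩ := exists_saturated ha.ge hH hM hMmax hC hbC
      (Set.subset_union_left (t := W' ∩ C))
      (Set.union_subset hMC fun v hv => .inl hv.2) ((hP C subset_rfl).start hbC)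
      fun D hD => (hP D (hD.trans Set.sdiff_subset)).start_of_subset hbC hD
    have hMW : M ⊆ W := Set.subset_union_left.trans hW₀
    have hbY := bdry_sdiff_subset hbC
    have hR := (RD.node (𝓢 := {∅}) (smallConn_of_pot h3 ha ⟨c, hcM⟩ hMk hMW hbC hWC hlink
      hPM)).attach_comps (Y := C \ M) (hbY.trans hMW) Set.inter_subset_left fun y hy => by
        have hDY := comp_subset (G := G) hy
        refine ih _ ?_ (isConnSet_comp y) (hM.subset ?_) (fun D hD => hPD D (hD.trans hDY)) rfl
        · rw [← hm]
          exact Set.ncard_lt_ncard ⟨hDY.trans Set.sdiff_subset, fun h => (hDY (h hcC)).2 hcM⟩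
            (Set.toFinite _)
        · exact fun v hv => hbY ⟨bdry_comp_subset hy hv, hv.2.imp fun d hd => ⟨hDY hd.1, hd.2⟩⟩
    refine ⟨W, ?_, Set.union_subset (hbC.trans hMW) (Set.subset_union_right.trans hW₀)⟩
    convert hR using 1
    refine (Set.union_subset (fun v hv => ?_) (hbC.trans (hMW.trans Set.subset_union_left))).antisymm
      (Set.union_subset hWC fun v hv => .inl hv.1)
    by_cases hvM : v ∈ M
    · exact .inl (hMW hvM)
    · exact .inr ⟨hv, hvM⟩

lemma exists_rd_smallConn [Finite V] [Nonempty V] (h3 : 3 ≤ cbn G) :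
    ∃ B, RD G (SmallConn G) {∅} B Set.univ := by
  obtain ⟨H, hH⟩ := exists_isMinChordal G
  obtain ⟨a, ha⟩ : ∃ a, a + 5 = 2 * cbn G := ⟨2 * cbn G - 5, by lia⟩
  have key : ∀ {C : Set V}, IsConnSet G C → bdry G C = ∅ →
      ∃ B, RD G (SmallConn G) {∅} B C := by
    intro C hC hbC
    obtain ⟨B, hB, -⟩ := exists_rd_smallConn_of_pot h3 ha hH hC (by simp [hbC])
      fun D _ => pot_empty G a D _
    exact ⟨B, by rwa [hbC, Set.union_empty] at hB⟩
  obtain ⟨v⟩ := ‹Nonempty V›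
  set C := comp G Set.univ v with hCdef
  have hbC : bdry G C = ∅ := by
    simpa using bdry_comp_subset (G := G) (Set.mem_univ v)
  obtain ⟨B, hB⟩ := key (isConnSet_comp v) hbC
  have hnb : ∀ x ∈ Cᶜ, ∀ y ∈ C, ¬ G.Adj x y := fun x hx y hy h =>
    (Set.eq_empty_iff_forall_notMem.1 hbC x) ⟨hx, y, hy, h.symm⟩
  refine ⟨B, ?_⟩
  rw [← Set.union_compl_self C]
  refine hB.attach_comps ?_ (fun x hx => absurd hx.1 hx.2) fun y hy => ?_
  · rintro x ⟨hx, z, hz, hzx⟩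
    exact absurd hzx (hnb z hz x (not_not.1 hx))
  · have hbD : bdry G (comp G Cᶜ y) = ∅ := Set.eq_empty_iff_forall_notMem.2 fun z hz => by
      obtain ⟨d, hd, hdz⟩ := hz.2
      exact hnb d (comp_subset hy hd) z (not_not.1 (bdry_comp_subset hy hz)) hdz
    obtain ⟨B', hB'⟩ := key (isConnSet_comp y) hbD
    refine ⟨B', by rwa [hbD, Set.union_empty], ?_⟩
    rintro x (hx | hx)
    · exact (hbD ▸ hx : x ∈ (∅ : Set V)).elim
    · exact absurd (hB.subset hx.1) (comp_subset hy hx.2)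

end

section

variable {V : Type u} {G : SimpleGraph V} {Q : Set V → Prop} {A B : Set V}

lemma LinkedIn.map {V' : Type u} {G' : SimpleGraph V'} {S : Set V} {S' : Set V'} {x y : V}
    (f : G →g G') (hf : ∀ v ∈ S, f v ∈ S') (h : LinkedIn G S x y) : LinkedIn G' S' (f x) (f y) := by
  induction h with
  | refl => rfl
  | tail _ h ih => exact ih.trans (.of_adj (f.map_adj h.1) (hf _ h.2.1) (hf _ h.2.2))

lemma isAcyclic_sum {ι ι' : Type u} {T : SimpleGraph ι} {T' : SimpleGraph ι'} (hT : T.IsAcyclic)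
    (hT' : T'.IsAcyclic) : (T ⊕g T').IsAcyclic := by
  have hl : ∀ {x y} (p : (T ⊕g T').Walk x y) (a : ι) (hx : x = .inl a),
      ∃ (b : ι) (q : T.Walk a b) (hy : y = .inl b),
        p.copy hx hy = q.map (Embedding.sumInl : T ↪g T ⊕g T').toHom := by
    intro x y p
    induction p with
    | nil => rintro a rfl; exact ⟨a, .nil, rfl, rfl⟩
    | @cons x z y h p ih =>
      rintro a rfl
      rcases z with z | z
      · obtain ⟨b, q, rfl, hq⟩ := ih z rfl
        exact ⟨b, .cons (sum_adj_inl.1 h) q, rfl, congrArg (Walk.cons h) hq⟩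
      · exact absurd h (not_adj_sum_inl_inr _ _)
  have hr : ∀ {x y} (p : (T ⊕g T').Walk x y) (a : ι') (hx : x = .inr a),
      ∃ (b : ι') (q : T'.Walk a b) (hy : y = .inr b),
        p.copy hx hy = q.map (Embedding.sumInr : T' ↪g T ⊕g T').toHom := by
    intro x y p
    induction p with
    | nil => rintro a rfl; exact ⟨a, .nil, rfl, rfl⟩
    | @cons x z y h p ih =>
      rintro a rfl
      rcases z with z | z
      · exact absurd h.symm (not_adj_sum_inl_inr _ _)
      · obtain ⟨b, q, rfl, hq⟩ := ih z rfl
        exact ⟨b, .cons (sum_adj_inr.1 h) q, rfl, congrArg (Walk.cons h) hq⟩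
  rintro (x | x) p hp
  · obtain ⟨b, q, hb, hq⟩ := hl p x rfl
    obtain rfl := Sum.inl_injective hb
    rw [Walk.copy_rfl_rfl] at hq
    subst hq
    exact hT q ((Walk.isCycle_map_iff_of_injective Sum.inl_injective).1 hp)
  · obtain ⟨b, q, hb, hq⟩ := hr p x rfl
    obtain rfl := Sum.inr_injective hb
    rw [Walk.copy_rfl_rfl] at hq
    subst hq
    exact hT' q ((Walk.isCycle_map_iff_of_injective Sum.inr_injective).1 hp)

lemma RD.exists_tree (h : RD G Q {∅} B A) :
    ∃ (ι : Type u) (T : SimpleGraph ι) (bag : ι → Set V) (r : ι), T.IsTree ∧ bag r = B ∧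
      (∀ v, v ∈ A ↔ ∃ t, v ∈ bag t) ∧ (∀ t, Q (bag t)) ∧
      (∀ u ∈ A, ∀ v ∈ A, G.Adj u v → ∃ t, u ∈ bag t ∧ v ∈ bag t) ∧
      ∀ v t₁ t₂, v ∈ bag t₁ → v ∈ bag t₂ → LinkedIn T {t | v ∈ bag t} t₁ t₂ := by
  induction h with
  | @node B hB =>
    refine ⟨PUnit, ⊥, fun _ => B, .unit, .of_subsingleton, rfl, fun v => by simp, fun _ => hB,
      fun u hu v hv _ => ⟨.unit, hu, hv⟩, fun v t₁ t₂ _ _ => .refl _⟩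
  | @leaf B A C _ hC _ _ ih =>
    obtain rfl : C = ∅ := hC
    rwa [Set.union_empty]
  | @attach B A B' A' _ _ hAA' _ hadj ih ih' =>
    obtain ⟨ι, T, bag, r, hT, rfl, hA, hQ, hE, hL⟩ := ih
    obtain ⟨ι', T', bag', r', hT', rfl, hA', hQ', hE', hL'⟩ := ih'
    set T₀ := (T ⊕g T') ⊔ edge (.inl r) (.inr r') with hT₀
    set bag₀ : ι ⊕ ι' → Set V := Sum.elim bag bag' with hbag₀
    have hLl : ∀ v t₁ t₂, v ∈ bag t₁ → v ∈ bag t₂ →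
        LinkedIn T₀ {t | v ∈ bag₀ t} (.inl t₁) (.inl t₂) := fun v t₁ t₂ h₁ h₂ =>
      (hL v t₁ t₂ h₁ h₂).map (G' := T₀)
        ((Hom.ofLE le_sup_left).comp (Embedding.sumInl : T ↪g T ⊕g T').toHom) fun _ h => h
    have hLr : ∀ v t₁ t₂, v ∈ bag' t₁ → v ∈ bag' t₂ →
        LinkedIn T₀ {t | v ∈ bag₀ t} (.inr t₁) (.inr t₂) := fun v t₁ t₂ h₁ h₂ =>
      (hL' v t₁ t₂ h₁ h₂).map (G' := T₀)
        ((Hom.ofLE le_sup_left).comp (Embedding.sumInr : T' ↪g T ⊕g T').toHom) fun _ h => h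
    have hLlr : ∀ v t₁ t₂, v ∈ bag t₁ → v ∈ bag' t₂ →
        LinkedIn T₀ {t | v ∈ bag₀ t} (.inl t₁) (.inr t₂) := by
      intro v t₁ t₂ h₁ h₂
      obtain ⟨hr, hr'⟩ := hAA' ⟨(hA v).2 ⟨_, h₁⟩, (hA' v).2 ⟨_, h₂⟩⟩
      have hrr : T₀.Adj (.inl r) (.inr r') := by simp [hT₀, edge_adj]
      exact ((hLl v t₁ r h₁ hr).trans (.of_adj hrr hr hr')).trans (hLr v r' t₂ hr' h₂)
    refine ⟨ι ⊕ ι', T₀, bag₀, .inl r, ⟨hT.connected.sum_sup_edge hT'.connected,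
      (isAcyclic_sum hT.isAcyclic hT'.isAcyclic).sup_edge_of_not_reachable
        (not_reachable_sum_inl_inr _ _)⟩, rfl, fun v => ?_, ?_, ?_, ?_⟩
    · rw [Set.mem_union, hA, hA', Sum.exists]
      rfl
    · exact Sum.forall.2 ⟨hQ, hQ'⟩
    · have hl : ∀ u ∈ A, ∀ v ∈ A, G.Adj u v → ∃ t, u ∈ bag₀ t ∧ v ∈ bag₀ t :=
        fun u hu v hv h => (hE u hu v hv h).elim fun t ht => ⟨.inl t, ht⟩
      have hr : ∀ u ∈ A', ∀ v ∈ A', G.Adj u v → ∃ t, u ∈ bag₀ t ∧ v ∈ bag₀ t :=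
        fun u hu v hv h => (hE' u hu v hv h).elim fun t ht => ⟨.inr t, ht⟩
      have hlr : ∀ u ∈ A, ∀ v ∈ A', G.Adj u v → ∃ t, u ∈ bag₀ t ∧ v ∈ bag₀ t :=
        fun u hu v hv h => (hadj u hu v hv h).elim (fun hu' => hr u hu' v hv h)
          fun hv' => hl u hu v hv' h
      rintro u (hu | hu) v (hv | hv) h
      · exact hl u hu v hv h
      · exact hlr u hu v hv h
      · exact (hlr v hv u hu h.symm).imp fun _ => And.symm
      · exact hr u hu v hv h
    · rintro v (t₁ | t₁) (t₂ | t₂) h₁ h₂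
      · exact hLl v t₁ t₂ h₁ h₂
      · exact hLlr v t₁ t₂ h₁ h₂
      · exact (hLlr v t₂ t₁ h₂ h₁).symm
      · exact hLr v t₁ t₂ h₁ h₂

lemma RD.exists_treeDecomp (h : RD G Q {∅} B Set.univ) :
    ∃ (ι : Type u) (T : SimpleGraph ι) (td : TreeDecomp G T), ∀ t, Q (td.bag t) := by
  classical
  obtain ⟨ι, T, bag, -, hT, -, hA, hQ, hE, hL⟩ := h.exists_tree
  refine ⟨ι, T, ⟨hT, bag, fun v => (hA v).1 (Set.mem_univ v),
    fun u v => hE u (Set.mem_univ u) v (Set.mem_univ v), ?_⟩, hQ⟩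
  rintro t₁ t₃ p hp t₂ ht₂ v ⟨h₁, h₃⟩
  obtain ⟨q, hq⟩ := (hL v t₁ t₃ h₁ h₃).exists_walk h₁
  have heq : p = q.bypass := congrArg Subtype.val
    ((hT.isAcyclic.subsingleton_path t₁ t₃).elim ⟨p, hp⟩ q.toPath)
  exact hq t₂ (q.support_bypass_subset_support (heq ▸ ht₂))

end

end ConnTW

/-- if `G` is not a forest then
`ctw(G) ≤ 2(cbn(G) − 1)(cbn(G) − 2)`. -/
theorem ctw_le_cbn {V : Type u} [Finite V] (G : SimpleGraph V)
    (h : ¬ G.IsAcyclic) :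
    ctw G ≤ 2 * (cbn G - 1) * (cbn G - 2) := by
  have : Nonempty V := by
    by_contra hV
    rw [not_nonempty_iff] at hV
    exact h .of_subsingleton
  obtain ⟨B, hB⟩ := ConnTW.exists_rd_smallConn (ConnTW.three_le_cbn h)
  obtain ⟨ι, T, td, htd⟩ := hB.exists_treeDecomp
  exact Nat.sInf_le ⟨ι, T, td, fun t => (htd t).1, fun t => (htd t).2⟩
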